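/- arXiv:2303.16864 — 5 statements merged into one kernel-verified Lean document; each statement's English description precedes it below -/
import Mathlib

section
/- For relatively prime odd positive integers m and n and any integer k, the Gauss-type sum satisfies G_k(mn) = G_k(m) · G_k(n). -/
open Complex

/-- The Gauss-type sum `G_k(n) = ((1-i)/2 + (-1/n)·(1+i)/2) · ∑_{a mod n} (a/n) e(ak/n)`,
where `(·/n)` is the Jacobi symbol and `e(x) = exp(2πix)`. -/
noncomputable def gaussG (k : ℤ) (n : ℕ) : ℂ :=
  ((1 - Complex.I) / 2 + (jacobiSym (-1) n : ℂ) * (1 + Complex.I) / 2) *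
    ∑ a ∈ Finset.range n,
      (jacobiSym (a : ℤ) n : ℂ) * Complex.exp (2 * Real.pi * Complex.I * a * k / n)

/-- The summand of the Gauss-type sum depends only on `a` modulo `n`. -/
theorem jacobiSym_mul_exp_mod (k : ℤ) {n : ℕ} (hn : n ≠ 0) (a : ℕ) :
    (jacobiSym ((a % n : ℕ) : ℤ) n : ℂ) *
        Complex.exp (2 * Real.pi * Complex.I * (a % n : ℕ) * k / n) =
      (jacobiSym (a : ℤ) n : ℂ) * Complex.exp (2 * Real.pi * Complex.I * a * k / n) := by
  have hn' : (n : ℂ) ≠ 0 := by exact_mod_cast hn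
  congr 1
  · rw [jacobiSym.mod_left (a : ℤ) n]
    push_cast
    rfl
  · rw [Complex.exp_eq_exp_iff_exists_int]
    refine ⟨-((a / n : ℕ) * k), ?_⟩
    have h : (a : ℂ) = (a % n : ℕ) + n * (a / n : ℕ) := by
      exact_mod_cast (Nat.mod_add_div a n).symm
    generalize a % n = r at *
    generalize a / n = q at *
    rw [h]
    push_cast
    field_simp
    ring

/-- The Chinese remainder parametrization of residues modulo `m * n`. -/
theorem sum_range_mul_of_coprime {M : Type*} [AddCommMonoid M] {m n : ℕ} (hm : 0 < m) (hn : 0 < n)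
    (hcop : Nat.Coprime m n) (f : ℕ → M) :
    ∑ a ∈ Finset.range (m * n), f a =
      ∑ x ∈ Finset.range m, ∑ y ∈ Finset.range n, f ((x * n + y * m) % (m * n)) := by
  rw [← Finset.sum_product']
  symm
  have hmaps : Set.MapsTo (fun p : ℕ × ℕ => (p.1 * n + p.2 * m) % (m * n))
      (Finset.range m ×ˢ Finset.range n : Finset (ℕ × ℕ)) (Finset.range (m * n)) := fun p _ => by
    simpa using Nat.mod_lt _ (Nat.mul_pos hm hn)
  have hinj : Set.InjOn (fun p : ℕ × ℕ => (p.1 * n + p.2 * m) % (m * n))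
      (Finset.range m ×ˢ Finset.range n : Finset (ℕ × ℕ)) := by
    rintro ⟨x, y⟩ hp ⟨x', y'⟩ hp' h
    simp only [Finset.coe_product, Finset.coe_range, Set.mem_prod, Set.mem_Iio] at hp hp'
    have h : x * n + y * m ≡ x' * n + y' * m [MOD m * n] := h
    have hx : x * n ≡ x' * n [MOD m] := by
      simpa [Nat.ModEq] using h.of_mul_right n
    have hy : y * m ≡ y' * m [MOD n] := by
      simpa [Nat.ModEq] using h.of_mul_left m
    exact Prod.ext ((hx.cancel_right_of_coprime hcop).eq_of_lt_of_lt hp.1 hp'.1)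
      ((hy.cancel_right_of_coprime hcop.symm).eq_of_lt_of_lt hp.2 hp'.2)
  exact Finset.sum_nbij _ hmaps hinj
    (Finset.surjOn_of_injOn_of_card_le _ hmaps hinj (by simp)) fun _ _ => rfl

theorem jacobiSym_mul_exp_crt (k : ℤ) {m n : ℕ} (hm : m ≠ 0) (hn : n ≠ 0) (x y : ℕ) :
    (jacobiSym ((x * n + y * m : ℕ) : ℤ) (m * n) : ℂ) *
        Complex.exp (2 * Real.pi * Complex.I * (x * n + y * m : ℕ) * k / (m * n : ℕ)) =
      (jacobiSym n m * jacobiSym m n : ℂ) *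
        (((jacobiSym x m : ℂ) * Complex.exp (2 * Real.pi * Complex.I * x * k / m)) *
          ((jacobiSym y n : ℂ) * Complex.exp (2 * Real.pi * Complex.I * y * k / n))) := by
  have hm' : (m : ℂ) ≠ 0 := by exact_mod_cast hm
  have hn' : (n : ℂ) ≠ 0 := by exact_mod_cast hn
  have hJm : jacobiSym ((x * n + y * m : ℕ) : ℤ) m = jacobiSym x m * jacobiSym n m := by
    rw [← jacobiSym.mul_left]
    exact jacobiSym.mod_left' (by simp)
  have hJn : jacobiSym ((x * n + y * m : ℕ) : ℤ) n = jacobiSym y n * jacobiSym m n := by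
    rw [← jacobiSym.mul_left]
    exact jacobiSym.mod_left' (by simp)
  have hexp : Complex.exp (2 * Real.pi * Complex.I * (x * n + y * m : ℕ) * k / (m * n : ℕ)) =
      Complex.exp (2 * Real.pi * Complex.I * x * k / m) *
        Complex.exp (2 * Real.pi * Complex.I * y * k / n) := by
    rw [← Complex.exp_add]
    congr 1
    push_cast
    field_simp
  rw [jacobiSym.mul_right' _ hm hn, hJm, hJn, hexp]
  push_cast
  ring

theorem jacobiSym_mul_swap_of_coprime {m n : ℕ} (hm : Odd m) (hn : Odd n)
    (hcop : Nat.Coprime m n) :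
    jacobiSym n m * jacobiSym m n = (-1) ^ (m / 2 * (n / 2)) := by
  have h : jacobiSym n m ^ 2 = 1 := jacobiSym.sq_one (by simpa using hcop.symm)
  rw [jacobiSym.quadratic_reciprocity hm hn]
  linear_combination (-1) ^ (m / 2 * (n / 2)) * h

/-- For relatively prime odd positive integers `m` and `n`, `G_k(mn) = G_k(m) G_k(n)`. -/
theorem gaussG_mul (m n : ℕ) (hm : 0 < m) (hn : 0 < n) (hmodd : Odd m) (hnodd : Odd n)
    (hcop : Nat.Coprime m n) (k : ℤ) :
    gaussG k (m * n) = gaussG k m * gaussG k n := by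
  have hconst : ((1 - I) / 2 + (jacobiSym (-1) (m * n) : ℂ) * (1 + I) / 2) *
      (jacobiSym n m * jacobiSym m n : ℂ) =
      ((1 - I) / 2 + (jacobiSym (-1) m : ℂ) * (1 + I) / 2) *
        ((1 - I) / 2 + (jacobiSym (-1) n : ℂ) * (1 + I) / 2) := by
    have hswap : (jacobiSym n m * jacobiSym m n : ℂ) = (-1) ^ (m / 2 * (n / 2)) := by
      exact_mod_cast congrArg (Int.cast : ℤ → ℂ) (jacobiSym_mul_swap_of_coprime hmodd hnodd hcop)
    rw [hswap, jacobiSym.mul_right' _ hm.ne' hn.ne', jacobiSym.at_neg_one hmodd,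
      jacobiSym.at_neg_one hnodd, ZMod.χ₄_eq_neg_one_pow (Nat.odd_iff.mp hmodd),
      ZMod.χ₄_eq_neg_one_pow (Nat.odd_iff.mp hnodd), pow_mul]
    push_cast
    rcases neg_one_pow_eq_or ℂ (m / 2) with h | h <;>
      rcases neg_one_pow_eq_or ℂ (n / 2) with h' | h' <;> rw [h] <;> simp only [h', one_pow] <;>
      first | ring1 | linear_combination (-1 : ℂ) * I_sq
  unfold gaussG
  rw [sum_range_mul_of_coprime hm hn hcop]
  simp_rw [jacobiSym_mul_exp_mod k (Nat.mul_pos hm hn).ne', jacobiSym_mul_exp_crt k hm.ne' hn.ne',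
    ← Finset.mul_sum, ← Finset.sum_mul]
  rw [← mul_assoc, hconst]
  ring
end

section
/- Let p be an odd prime, let k be a nonzero integer, and let α be the p-adic valuation of k (so p^α ∥ k). Then for a positive integer β: G_k(p^β) = 0 if β ≤ α and β is odd; G_k(p^β) = φ(p^β) if β ≤ α and β is even; G_k(p^β) = −p^α if β = α+1 and β is even; G_k(p^β) = (k·p^{−α} / p) · p^α · √p if β = α+1 and β is odd, where (·/p) is the Legendre symbol; and G_k(p^β) = 0 if β ≥ α+2. -/
open Complex

open Polynomial in
/-- The Euler operator `f ↦ X f'` on polynomials. -/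
noncomputable def eulerOp (R : Type*) [CommRing R] : Module.End R R[X] :=
  LinearMap.mulLeft R X ∘ₗ derivative

open Polynomial in
theorem eulerOp_pow_monomial {R : Type*} [CommRing R] (m j : ℕ) (a : R) :
    (eulerOp R ^ m) (C a * X ^ j) = C (a * (j : R) ^ m) * X ^ j := by
  induction m with
  | zero => simp
  | succ m ih =>
    rw [pow_succ', Module.End.mul_apply, ih]
    cases j with
    | zero => cases m <;> simp [eulerOp]
    | succ j =>
      simp only [eulerOp, LinearMap.comp_apply, LinearMap.mulLeft_apply, derivative_C_mul,
        derivative_X_pow]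
      simp only [map_mul, map_pow, map_natCast, Nat.add_sub_cancel]
      ring

open Polynomial in
theorem eval_one_eulerOp_pow {R : Type*} [CommRing R] (m : ℕ) (Q : R[X]) :
    ((eulerOp R ^ m) ((X - 1) ^ m * Q)).eval 1 = (m.factorial : R) * Q.eval 1 := by
  induction m generalizing Q with
  | zero => simp
  | succ m ih =>
    have h : eulerOp R ((X - 1) ^ (m + 1) * Q) =
        (X - 1) ^ m * (X * ((m + 1 : R[X]) * Q + (X - 1) * derivative Q)) := by
      simp only [eulerOp, LinearMap.comp_apply, LinearMap.mulLeft_apply, derivative_mul,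
        derivative_pow, derivative_sub, derivative_X, derivative_one, Nat.add_sub_cancel,
        map_natCast]
      push_cast
      ring
    rw [pow_succ, Module.End.mul_apply, h, ih]
    simp [Nat.factorial_succ]
    ring

open Polynomial in
theorem X_sub_one_dvd_X_pow_sub_X_pow {R : Type*} [CommRing R] (a b : ℕ) :
    ∃ q : R[X], X ^ a - X ^ b = (X - 1) * q ∧ q.eval 1 = (a : R) - b := by
  refine ⟨∑ i ∈ Finset.range a, X ^ i - ∑ i ∈ Finset.range b, X ^ i, ?_, ?_⟩
  · rw [mul_sub, mul_geom_sum, mul_geom_sum]; ring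
  · simp [eval_finsetSum]

theorem ZMod.factorial_mul_prod_neg {p : ℕ} [Fact p.Prime] {m : ℕ} (hm : p = 2 * m + 1) :
    (m.factorial : ZMod p) * ∏ k ∈ Finset.range m, (-((k : ZMod p) + 1)) = -1 := by
  rw [← ZMod.wilsons_lemma p, show p - 1 = m + m by omega,
    ← Finset.prod_range_add_one_eq_factorial, ← Finset.prod_range_add_one_eq_factorial,
    Finset.prod_range_add]
  push_cast
  congr 1
  rw [← Finset.prod_range_reflect]
  refine Finset.prod_congr rfl fun k hk => ?_
  have hk := Finset.mem_range.1 hk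
  have h : ((p : ℕ) : ZMod p) = 0 := ZMod.natCast_self p
  have e : p = (m - 1 - k + 1) + (m + k + 1) := by omega
  have h := (congrArg (Nat.cast : ℕ → ZMod p) e).symm.trans h
  push_cast at h
  linear_combination -h

open Polynomial in
/-- Both polynomials agree to order `(p-1)/2` at `1` modulo `p`, which pins down the sign. -/
theorem sign_eq_one_of_cyclotomic_dvd {p : ℕ} [Fact p.Prime] {m : ℕ} (hm : p = 2 * m + 1)
    {ε : ℤ} (hε : ε = 1 ∨ ε = -1)
    (h : cyclotomic p ℤ ∣ (∑ j ∈ Finset.range p, C (legendreSym p j) * X ^ j) -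
      C ε * ∏ k ∈ Finset.range m, (X ^ (m * (k + 1)) - X ^ ((m + 1) * (k + 1)))) :
    ε = 1 := by
  have hm1 : 1 ≤ m := by
    have := (Fact.out : p.Prime).two_le
    omega
  have h := Polynomial.map_dvd (Int.castRingHom (ZMod p)) h
  have hc : cyclotomic p (ZMod p) = (X - 1) ^ (m + 1) * (X - 1) ^ (m - 1) := by
    have := cyclotomic_mul_prime_eq_pow_of_not_dvd (ZMod p) (n := 1) (p := p)
      (Fact.out : p.Prime).not_dvd_one
    rw [one_mul, cyclotomic_one] at this
    rw [this, ← pow_add]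
    congr 1
    omega
  rw [map_cyclotomic, hc] at h
  obtain ⟨S, hS⟩ := h
  choose q hq hq1 using fun k : ℕ =>
    X_sub_one_dvd_X_pow_sub_X_pow (R := ZMod p) (m * (k + 1)) ((m + 1) * (k + 1))
  have hS' := congrArg (fun f => ((eulerOp (ZMod p) ^ m) f).eval 1) hS
  have hr : ((X : (ZMod p)[X]) - 1) ^ (m + 1) * (X - 1) ^ (m - 1) * S =
      (X - 1) ^ m * ((X - 1) * (X - 1) ^ (m - 1) * S) := by ring
  simp only [hr, eval_one_eulerOp_pow] at hS'
  simp only [Polynomial.map_sub, Polynomial.map_mul, Polynomial.map_sum, Polynomial.map_prod,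
    Polynomial.map_pow, map_X, map_C, hq, Finset.prod_mul_distrib, Finset.prod_const,
    Finset.card_range, map_sub, map_sum, eulerOp_pow_monomial, eval_sub] at hS'
  rw [show C ((Int.castRingHom (ZMod p)) ε) * ((X - 1) ^ m * ∏ k ∈ Finset.range m, q k) =
    (X - 1) ^ m * (C ((Int.castRingHom (ZMod p)) ε) * ∏ k ∈ Finset.range m, q k) by ring,
    eval_one_eulerOp_pow] at hS'
  have hg : ∑ j ∈ Finset.range p, ((legendreSym p j : ZMod p) * (j : ZMod p) ^ m) = -1 := by
    have hj : ∀ j ∈ Finset.range p, (legendreSym p j : ZMod p) * (j : ZMod p) ^ m =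
        if j = 0 then 0 else 1 := by
      intro j hj
      rw [legendreSym.eq_pow, show p / 2 = m by omega, Int.cast_natCast, ← pow_add]
      split_ifs with h0
      · subst h0; simp; omega
      · have := ZMod.pow_card_sub_one_eq_one (p := p) (a := (j : ZMod p)) (by
          rw [Ne, ZMod.natCast_eq_zero_iff]
          exact fun hd => h0 (Nat.eq_zero_of_dvd_of_lt hd (Finset.mem_range.1 hj)))
        rw [← this]
        congr 1
        omega
    rw [Finset.sum_congr rfl hj, congrArg Finset.range hm, Finset.sum_range_succ', Finset.sum_congr rfl
      (fun j _ => if_neg (Nat.succ_ne_zero j))]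
    have h : ((p : ℕ) : ZMod p) = 0 := ZMod.natCast_self p
    have h := (congrArg (Nat.cast : ℕ → ZMod p) hm).symm.trans h
    push_cast at h
    simp
    linear_combination h
  have hd : (m.factorial : ZMod p) * ∏ k ∈ Finset.range m, (q k).eval 1 = -1 := by
    rw [← ZMod.factorial_mul_prod_neg hm]
    congr 1
    refine Finset.prod_congr rfl fun k _ => ?_
    rw [hq1]
    push_cast
    ring
  simp only [eval_finsetSum, eval_mul, eval_C, eval_pow, eval_X, one_pow, mul_one, eval_prod,
    eval_sub, eval_one, sub_self, zero_mul, mul_zero, eq_intCast] at hS'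
  rw [hg] at hS'
  rcases hε with rfl | rfl
  · rfl
  · exfalso
    have h2 : (2 : ZMod p) = 0 := by
      push_cast at hS'
      linear_combination -hS' + hd
    have : ((2 : ℕ) : ZMod p) = 0 := by exact_mod_cast h2
    rw [ZMod.natCast_eq_zero_iff] at this
    have := Nat.le_of_dvd two_pos this
    omega

theorem exp_pow_sub_exp_pow {p m : ℕ} (hm : p = 2 * m + 1) (k : ℕ) :
    exp (2 * Real.pi * I / p) ^ (m * (k + 1)) - exp (2 * Real.pi * I / p) ^ ((m + 1) * (k + 1)) =
      I ^ (2 * k + 1) * ((2 * Real.sin (Real.pi * (k + 1) / p) : ℝ) : ℂ) := by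
  have hp : (p : ℂ) ≠ 0 := by
    exact_mod_cast show p ≠ 0 by omega
  have hpm : (p : ℂ) = 2 * m + 1 := by rw [hm]; push_cast; rfl
  have hk : exp (Real.pi * I) ^ (k + 1) = -I ^ (2 * k) := by
    rw [exp_pi_mul_I, pow_mul, I_sq]; ring
  have h1 : exp (2 * Real.pi * I / p) ^ (m * (k + 1)) =
      exp (Real.pi * I) ^ (k + 1) * exp (-(Real.pi * (k + 1) / p * I)) := by
    rw [← exp_nat_mul, ← exp_nat_mul, ← exp_add]
    congr 1
    field_simp
    rw [hpm]
    push_cast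
    ring
  have h2 : exp (2 * Real.pi * I / p) ^ ((m + 1) * (k + 1)) =
      exp (Real.pi * I) ^ (k + 1) * exp (Real.pi * (k + 1) / p * I) := by
    rw [← exp_nat_mul, ← exp_nat_mul, ← exp_add]
    congr 1
    field_simp
    rw [hpm]
    push_cast
    ring
  rw [h1, h2, hk]
  push_cast
  rw [Complex.sin, pow_succ, neg_mul (Real.pi * (k + 1) / p : ℂ)]
  linear_combination (-I ^ (2 * k) * (exp (-(Real.pi * (k + 1) / p * I)) -
    exp (Real.pi * (k + 1) / p * I))) * I_sq

theorem prod_two_mul_sin {p m : ℕ} (hm : p = 2 * m + 1) :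
    ∏ k ∈ Finset.range m, (2 * Real.sin (Real.pi * (k + 1) / p)) = Real.sqrt p := by
  have hp0 : p ≠ 0 := by omega
  have hpR : (0 : ℝ) < p := by exact_mod_cast Nat.pos_of_ne_zero hp0
  have hζ := Complex.isPrimitiveRoot_exp p hp0
  set ζ := exp (2 * Real.pi * I / p) with hζdef
  have hn : ∀ j : ℕ, ‖ζ ^ j‖ = 1 := fun j => by
    rw [norm_pow, hζ.norm'_eq_one hp0, one_pow]
  have hnonneg : ∀ k ∈ Finset.range m, 0 ≤ 2 * Real.sin (Real.pi * (k + 1) / p) := by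
    intro k hk
    have hk : k + 1 ≤ p := by have := Finset.mem_range.1 hk; omega
    have hk' : ((k : ℝ) + 1) ≤ p := by exact_mod_cast hk
    refine mul_nonneg zero_le_two (Real.sin_nonneg_of_nonneg_of_le_pi (by positivity) ?_)
    rw [div_le_iff₀ hpR]
    exact mul_le_mul_of_nonneg_left hk' Real.pi_pos.le
  have hsin : ∀ k ∈ Finset.range m, ‖1 - ζ ^ (k + 1)‖ = 2 * Real.sin (Real.pi * (k + 1) / p) := by
    intro k hk
    have h := congrArg norm (exp_pow_sub_exp_pow hm k)
    rw [← hζdef, add_mul, one_mul, pow_add, ← mul_one_sub, norm_mul, hn, one_mul, norm_mul,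
      norm_pow, norm_I, one_pow, one_mul, Complex.norm_real, Real.norm_of_nonneg (hnonneg k hk)] at h
    exact h
  have hrefl : ∀ k ∈ Finset.range m, ‖1 - ζ ^ (m + (m - 1 - k) + 1)‖ = ‖1 - ζ ^ (k + 1)‖ := by
    intro k hk
    have hk := Finset.mem_range.1 hk
    have h : ζ ^ (m + (m - 1 - k) + 1) * ζ ^ (k + 1) = 1 := by
      rw [← pow_add, ← hζ.pow_eq_one]
      congr 1
      omega
    calc ‖1 - ζ ^ (m + (m - 1 - k) + 1)‖ = ‖(1 - ζ ^ (m + (m - 1 - k) + 1)) * ζ ^ (k + 1)‖ := by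
          rw [norm_mul, hn, mul_one]
      _ = ‖ζ ^ (k + 1) - 1‖ := by rw [sub_mul, h, one_mul]
      _ = _ := norm_sub_rev _ _
  have hprod := congrArg norm (IsPrimitiveRoot.prod_one_sub_pow_eq_order (n := m + m)
    (by rw [show m + m + 1 = p by omega]; exact hζ))
  rw [norm_prod, Finset.prod_range_add, ← Finset.prod_range_reflect (fun k => ‖1 - ζ ^ (m + k + 1)‖),
    Finset.prod_congr rfl hrefl, Finset.prod_congr rfl hsin] at hprod
  symm
  rw [Real.sqrt_eq_iff_mul_self_eq hpR.le (Finset.prod_nonneg hnonneg), hprod]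
  rw [show ((m + m : ℕ) : ℂ) + 1 = ((p : ℕ) : ℂ) by rw [hm]; push_cast; ring, Complex.norm_natCast]

theorem ZMod.sum_range_natCast {M : Type*} [AddCommMonoid M] (n : ℕ) [NeZero n] (f : ZMod n → M) :
    ∑ j ∈ Finset.range n, f (j : ZMod n) = ∑ x, f x := by
  refine Finset.sum_nbij' (fun j => (j : ZMod n)) ZMod.val ?_ ?_ ?_ ?_ ?_
  · simp
  · intro x _; exact Finset.mem_range.2 (ZMod.val_lt x)
  · intro j hj; exact ZMod.val_cast_of_lt (Finset.mem_range.1 hj)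
  · intro x _; exact ZMod.natCast_zmod_val x
  · simp

/-- The quadratic Gauss sum modulo `p = 2 * m + 1` equals `i^(m²) √p`. -/
theorem gaussSum_quadraticChar_stdAddChar {p : ℕ} [Fact p.Prime] {m : ℕ} (hm : p = 2 * m + 1) :
    gaussSum ((quadraticChar (ZMod p)).ringHomComp (Int.castRingHom ℂ)) ZMod.stdAddChar =
      I ^ (m ^ 2) * Real.sqrt p := by
  have hp0 : p ≠ 0 := by omega
  have hp2 : ringChar (ZMod p) ≠ 2 := by rw [ZMod.ringChar_zmod_n]; omega
  set ζ := exp (2 * Real.pi * I / p) with hζdef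
  have hζ : IsPrimitiveRoot ζ p := Complex.isPrimitiveRoot_exp p hp0
  have hD : ∏ k ∈ Finset.range m, (ζ ^ (m * (k + 1)) - ζ ^ ((m + 1) * (k + 1))) =
      I ^ (m ^ 2) * Real.sqrt p := by
    simp_rw [hζdef, exp_pow_sub_exp_pow hm]
    rw [Finset.prod_mul_distrib, Finset.prod_pow_eq_pow_sum, ← prod_two_mul_sin hm]
    push_cast
    congr 2
    rw [Finset.sum_add_distrib, ← Finset.mul_sum, mul_comm, Finset.sum_range_id_mul_two]
    cases m <;> simp; ring
  have hg : gaussSum ((quadraticChar (ZMod p)).ringHomComp (Int.castRingHom ℂ)) ZMod.stdAddChar =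
      ∑ j ∈ Finset.range p, (legendreSym p j : ℂ) * ζ ^ j := by
    rw [gaussSum, ← ZMod.sum_range_natCast]
    refine Finset.sum_congr rfl fun j _ => ?_
    have h := ZMod.stdAddChar_coe (N := p) (j : ℤ)
    simp only [Int.cast_natCast] at h
    rw [h, hζdef, ← exp_nat_mul]
    congr 1
    · simp [legendreSym]
    · congr 1; ring
  have hsq : gaussSum ((quadraticChar (ZMod p)).ringHomComp (Int.castRingHom ℂ))
      ZMod.stdAddChar ^ 2 = (I ^ (m ^ 2) * Real.sqrt p) ^ 2 := by
    rw [gaussSum_sq (MulChar.ringHomComp_ne_one_iff (RingHom.injective_int _) |>.2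
        (quadraticChar_ne_one hp2)) ((quadraticChar_isQuadratic _).comp _)
        (ZMod.isPrimitive_stdAddChar p), ZMod.card, mul_pow, ← ofReal_pow,
        Real.sq_sqrt (Nat.cast_nonneg p), ofReal_natCast]
    congr 1
    have h := legendreSym.at_neg_one (p := p) (by omega)
    rw [ZMod.χ₄_eq_neg_one_pow (by omega), show p / 2 = m by omega, legendreSym] at h
    push_cast at h
    rw [MulChar.ringHomComp_apply, h, ← pow_mul, mul_comm, pow_mul, I_sq]
    rcases Nat.even_or_odd m with h | h
    · simp [h.neg_one_pow, (h.pow_of_ne_zero two_ne_zero).neg_one_pow]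
    · simp [h.neg_one_pow, h.pow.neg_one_pow]
  rcases sq_eq_sq_iff_eq_or_eq_neg.1 hsq with h | h
  · exact h
  · exfalso
    have := sign_eq_one_of_cyclotomic_dvd hm (ε := -1) (Or.inr rfl) (by
      rw [Polynomial.cyclotomic_eq_minpoly hζ (Nat.pos_of_ne_zero hp0)]
      refine minpoly.isIntegrallyClosed_dvd (hζ.isIntegral (Nat.pos_of_ne_zero hp0)) ?_
      simp only [map_sub, map_sum, map_mul, map_prod, map_pow,
        Polynomial.aeval_X, eq_intCast, map_intCast]
      rw [hD, ← hg, h]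
      push_cast
      ring)
    omega

theorem Finset.sum_range_mul_eq {M : Type*} [AddCommMonoid M] (f : ℕ → M) (p N : ℕ) :
    ∑ a ∈ Finset.range (p * N), f a =
      ∑ c ∈ Finset.range N, ∑ b ∈ Finset.range p, f (p * c + b) := by
  induction N with
  | zero => simp
  | succ N ih => rw [mul_add_one, Finset.sum_range_add, ih, Finset.sum_range_succ]

theorem sum_exp_pow_eq {N : ℕ} (hN : N ≠ 0) (k : ℤ) :
    ∑ c ∈ Finset.range N, exp (2 * Real.pi * I * k / N) ^ c = if (N : ℤ) ∣ k then (N : ℂ) else 0 := by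
  have hζ := Complex.isPrimitiveRoot_exp N hN
  have hw : exp (2 * Real.pi * I * k / N) = exp (2 * Real.pi * I / N) ^ k := by
    rw [← exp_int_mul]
    congr 1
    ring
  have hN1 : (exp (2 * Real.pi * I / N) ^ k) ^ N = 1 := by
    rw [← zpow_natCast, zpow_comm, zpow_natCast, hζ.pow_eq_one, one_zpow]
  rw [hw]
  split_ifs with h
  · rw [(hζ.zpow_eq_one_iff_dvd k).2 h]
    simp
  · have h1 := mt (hζ.zpow_eq_one_iff_dvd k).1 h
    rw [geom_sum_eq h1, hN1, sub_self, zero_div]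

theorem sum_jacobiSym_prime_pow_succ (p : ℕ) [Fact p.Prime] (k : ℤ) (n : ℕ) :
    ∑ a ∈ Finset.range (p ^ (n + 1)), (jacobiSym (a : ℤ) (p ^ (n + 1)) : ℂ) *
        exp (2 * Real.pi * I * a * k / (p ^ (n + 1) : ℕ)) =
      (if ((p : ℤ) ^ n) ∣ k then (p : ℂ) ^ n else 0) *
        ∑ b ∈ Finset.range p, (legendreSym p b : ℂ) ^ (n + 1) *
          exp (2 * Real.pi * I * b * k / (p ^ (n + 1) : ℕ)) := by
  have hp : (p : ℂ) ≠ 0 := by exact_mod_cast (Fact.out : p.Prime).ne_zero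
  have h := sum_exp_pow_eq (pow_ne_zero n (Fact.out : p.Prime).ne_zero) k
  push_cast at h
  rw [← h, pow_succ', Finset.sum_range_mul_eq, Finset.sum_mul]
  refine Finset.sum_congr rfl fun c _ => ?_
  rw [Finset.mul_sum]
  refine Finset.sum_congr rfl fun b _ => ?_
  have hmod : legendreSym p ((p * c + b : ℕ) : ℤ) = legendreSym p b := by
    rw [legendreSym, legendreSym]
    congr 1
    simp
  rw [← pow_succ', jacobiSym.pow_right, ← jacobiSym.legendreSym.to_jacobiSym, hmod, ← exp_nat_mul,
    mul_left_comm, ← exp_add]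
  push_cast
  congr 2
  field_simp
  ring

theorem sum_legendreSym_pow_mul_exp {p : ℕ} [Fact p.Prime] (k : ℤ) (n : ℕ) :
    ∑ b ∈ Finset.range p, (legendreSym p b : ℂ) ^ n * exp (2 * Real.pi * I * b * k / p) =
      ∑ x : ZMod p, (quadraticChar (ZMod p) x : ℂ) ^ n * ZMod.stdAddChar ((k : ZMod p) * x) := by
  rw [← ZMod.sum_range_natCast]
  refine Finset.sum_congr rfl fun b _ => ?_
  have h := ZMod.stdAddChar_coe (N := p) (k * b)
  push_cast at h
  rw [h, legendreSym, Int.cast_natCast]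
  congr 2
  ring

theorem sum_quadraticChar_pow_even {p : ℕ} [Fact p.Prime] (k : ZMod p) {n : ℕ} (hn : Even n)
    (hn0 : n ≠ 0) :
    ∑ x : ZMod p, (quadraticChar (ZMod p) x : ℂ) ^ n * ZMod.stdAddChar (k * x) =
      (if k = 0 then (p : ℂ) else 0) - 1 := by
  have h : ∀ x : ZMod p, (quadraticChar (ZMod p) x : ℂ) ^ n * ZMod.stdAddChar (k * x) =
      ZMod.stdAddChar (x * (k - 0)) - if x = 0 then 1 else 0 := by
    intro x
    rw [sub_zero, mul_comm x]
    split_ifs with hx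
    · simp [hx, hn0]
    · obtain ⟨r, rfl⟩ := hn
      rw [← two_mul, pow_mul, ← Int.cast_pow, quadraticChar_sq_one hx]
      simp
  rw [Finset.sum_congr rfl fun x _ => h x, Finset.sum_sub_distrib,
    AddChar.sum_mulShift _ (ZMod.isPrimitive_stdAddChar p)]
  simp [ZMod.card]

theorem sum_quadraticChar_pow_odd {p : ℕ} [Fact p.Prime] (hp : p ≠ 2) (k : ZMod p) {n : ℕ}
    (hn : Odd n) :
    ∑ x : ZMod p, (quadraticChar (ZMod p) x : ℂ) ^ n * ZMod.stdAddChar (k * x) =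
      quadraticChar (ZMod p) k *
        gaussSum ((quadraticChar (ZMod p)).ringHomComp (Int.castRingHom ℂ)) ZMod.stdAddChar := by
  have hpow : ∀ x : ZMod p, (quadraticChar (ZMod p) x : ℂ) ^ n = quadraticChar (ZMod p) x := by
    intro x
    rcases quadraticChar_isQuadratic (ZMod p) x with h | h | h <;>
      simp [h, hn.pos.ne', hn.neg_one_pow]
  simp_rw [hpow]
  rcases eq_or_ne k 0 with rfl | hk
  · have h := quadraticChar_sum_zero (F := ZMod p) (by rwa [ZMod.ringChar_zmod_n])
    simp only [zero_mul, AddChar.map_zero_eq_one, mul_one, ← Int.cast_sum, h, MulChar.map_zero,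
      Int.cast_zero]
  · have h := gaussSum_mulShift ((quadraticChar (ZMod p)).ringHomComp (Int.castRingHom ℂ))
      ZMod.stdAddChar (Units.mk0 k hk)
    rw [← h, ← mul_assoc]
    have h2 : (quadraticChar (ZMod p) k : ℂ) ^ 2 = 1 := by
      exact_mod_cast quadraticChar_sq_one hk
    simp only [gaussSum, MulChar.ringHomComp_apply, Units.val_mk0, eq_intCast,
      AddChar.mulShift_apply]
    rw [← sq, h2, one_mul]

theorem prefactor_even {p : ℕ} [Fact p.Prime] {n : ℕ} (hn : Even n) :
    (1 - I) / 2 + (jacobiSym (-1) (p ^ n) : ℂ) * (1 + I) / 2 = 1 := by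
  have h0 : ((-1 : ℤ) : ZMod p) ≠ 0 := by simp
  obtain ⟨r, rfl⟩ := hn
  rw [jacobiSym.pow_right, ← jacobiSym.legendreSym.to_jacobiSym, ← two_mul, pow_mul, legendreSym.sq_one p h0]
  simp
  ring

theorem prefactor_odd_mul {p : ℕ} [Fact p.Prime] {m : ℕ} (hm : p = 2 * m + 1) {n : ℕ}
    (hn : Odd n) :
    ((1 - I) / 2 + (jacobiSym (-1) (p ^ n) : ℂ) * (1 + I) / 2) * I ^ (m ^ 2) = 1 := by
  have hJ : jacobiSym (-1) (p ^ n) = (-1) ^ m := by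
    rw [jacobiSym.pow_right, ← jacobiSym.legendreSym.to_jacobiSym, legendreSym.at_neg_one (by omega),
      ZMod.χ₄_eq_neg_one_pow (by omega), show p / 2 = m by omega, ← pow_mul, mul_comm, pow_mul,
      hn.neg_one_pow]
  rw [hJ]
  obtain ⟨r, rfl | rfl⟩ := Nat.even_or_odd' m
  · rw [show (2 * r) ^ 2 = 4 * r ^ 2 by ring, pow_mul I, I_pow_four]
    simp [pow_mul]
    ring
  · rw [show (2 * r + 1) ^ 2 = 4 * (r ^ 2 + r) + 1 by ring, pow_succ I, pow_mul I, I_pow_four]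
    simp [pow_succ, pow_mul]
    linear_combination -I_sq

theorem gaussG_prime_pow_succ {p : ℕ} [Fact p.Prime] (k : ℤ) (n : ℕ) :
    gaussG ((p : ℤ) ^ n * k) (p ^ (n + 1)) =
      ((1 - I) / 2 + (jacobiSym (-1) (p ^ (n + 1)) : ℂ) * (1 + I) / 2) * ((p : ℂ) ^ n *
        ∑ x : ZMod p, (quadraticChar (ZMod p) x : ℂ) ^ (n + 1) *
          ZMod.stdAddChar ((k : ZMod p) * x)) := by
  have hp : (p : ℂ) ≠ 0 := by exact_mod_cast (Fact.out : p.Prime).ne_zero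
  rw [gaussG, sum_jacobiSym_prime_pow_succ, if_pos (dvd_mul_right _ _),
    ← sum_legendreSym_pow_mul_exp]
  congr 3
  ext b
  congr 2
  push_cast
  field_simp
  ring

theorem gaussG_prime_pow_succ_of_even {p : ℕ} [Fact p.Prime] (k : ℤ) {n : ℕ}
    (hn : Even (n + 1)) :
    gaussG ((p : ℤ) ^ n * k) (p ^ (n + 1)) =
      (p : ℂ) ^ n * ((if (k : ZMod p) = 0 then (p : ℂ) else 0) - 1) := by
  rw [gaussG_prime_pow_succ, prefactor_even hn, one_mul,
    sum_quadraticChar_pow_even _ hn n.succ_ne_zero]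

theorem gaussG_prime_pow_succ_of_odd {p : ℕ} [Fact p.Prime] (hp : p ≠ 2) (k : ℤ) {n : ℕ}
    (hn : Odd (n + 1)) :
    gaussG ((p : ℤ) ^ n * k) (p ^ (n + 1)) =
      (legendreSym p k : ℂ) * (p : ℂ) ^ n * Real.sqrt p := by
  obtain ⟨m, hm⟩ := (Fact.out : p.Prime).odd_of_ne_two hp
  rw [gaussG_prime_pow_succ, sum_quadraticChar_pow_odd hp _ hn,
    gaussSum_quadraticChar_stdAddChar hm, legendreSym]
  linear_combination ((quadraticChar (ZMod p) (k : ZMod p) : ℂ) * (p : ℂ) ^ n * Real.sqrt p) *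
    prefactor_odd_mul hm hn

/-- Evaluation of `G_k(p^β)` for an odd prime `p`, a nonzero integer `k` with
`p`-adic valuation `α`, and a positive integer `β`. -/
theorem gaussG_prime_pow (p : ℕ) [Fact p.Prime] (hodd : Odd p)
    (k : ℤ) (hk : k ≠ 0) (α : ℕ) (hα : α = padicValInt p k) (β : ℕ) (hβ : 0 < β) :
    (β ≤ α → Odd β → gaussG k (p ^ β) = 0) ∧
    (β ≤ α → Even β → gaussG k (p ^ β) = Nat.totient (p ^ β)) ∧
    (β = α + 1 → Even β → gaussG k (p ^ β) = -(p : ℂ) ^ α) ∧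
    (β = α + 1 → Odd β →
      gaussG k (p ^ β) = (legendreSym p (k / (p : ℤ) ^ α) : ℂ) * (p : ℂ) ^ α * Real.sqrt p) ∧
    (α + 2 ≤ β → gaussG k (p ^ β) = 0) := by
  have hpp : p.Prime := Fact.out
  have hp : p ≠ 2 := by rintro rfl; exact absurd hodd (by decide)
  have hdvd : ∀ n : ℕ, (p : ℤ) ^ n ∣ k ↔ n ≤ α := fun n => by
    rw [padicValInt_dvd_iff, hα, or_iff_right hk]
  obtain ⟨n, rfl⟩ := Nat.exists_eq_succ_of_ne_zero hβ.ne'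
  rw [Nat.succ_eq_add_one]
  have small : n + 1 ≤ α → ∃ k' : ℤ, k = (p : ℤ) ^ n * k' ∧ ((k' : ℤ) : ZMod p) = 0 := by
    intro h
    obtain ⟨l, hl⟩ := (hdvd (n + 1)).2 h
    exact ⟨p * l, by rw [hl]; ring, by simp⟩
  have exact_val : ∀ k' : ℤ, k = (p : ℤ) ^ α * k' → ((k' : ℤ) : ZMod p) ≠ 0 := by
    intro k' hk' h0
    obtain ⟨l, rfl⟩ := (ZMod.intCast_zmod_eq_zero_iff_dvd k' p).1 h0
    have := (hdvd (α + 1)).1 ⟨l, by rw [hk']; ring⟩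
    omega
  refine ⟨fun h ho => ?_, fun h he => ?_, fun h he => ?_, fun h ho => ?_, fun h => ?_⟩
  · obtain ⟨k', hk', h0⟩ := small h
    rw [hk', gaussG_prime_pow_succ_of_odd hp k' ho, (legendreSym.eq_zero_iff p k').2 h0]
    simp
  · obtain ⟨k', hk', h0⟩ := small h
    rw [hk', gaussG_prime_pow_succ_of_even k' he, if_pos h0, Nat.totient_prime_pow_succ hpp]
    push_cast [Nat.cast_sub hpp.one_le]
    rfl
  · obtain rfl : n = α := by omega
    obtain ⟨k', hk'⟩ := (hdvd n).2 le_rfl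
    rw [hk', gaussG_prime_pow_succ_of_even k' he, if_neg (exact_val k' hk')]
    ring
  · obtain rfl : n = α := by omega
    obtain ⟨k', hk'⟩ := (hdvd n).2 le_rfl
    have hdiv : k / (p : ℤ) ^ n = k' := by
      rw [hk', Int.mul_ediv_cancel_left _ (pow_ne_zero n (by exact_mod_cast hpp.ne_zero))]
    rw [hdiv, hk', gaussG_prime_pow_succ_of_odd hp k' ho]
  · rw [gaussG, sum_jacobiSym_prime_pow_succ, if_neg (by rw [hdvd]; omega)]
    simp
end

section
/- Let H : ℝ → ℝ be a Schwartz class function whose support is contained in (0, ∞), let n be an odd positive integer, and let X > 0 be real. Then ∑_{d ≥ 1, d odd} (8d/n) · H(d/X) = [n is a perfect square] · (X/2) · Ȟ(0) · ∏_{p | n} (1 − 1/p) + (X/2) · ∑_{k ∈ ℤ, k ≠ 0} (−1)^k · (G_k(n)/n) · Ȟ(Xk/(2n)), where (8d/n) is the Jacobi symbol, the product runs over primes p dividing n, and [·] is 1 if the condition holds and 0 otherwise. -/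
open Complex

/-- The Fourier-type transform `Ȟ(y) = ∫ (cos(2πxy) + sin(2πxy)) H(x) dx`. -/
noncomputable def fourierCheck (H : SchwartzMap ℝ ℝ) (y : ℝ) : ℝ :=
  ∫ x : ℝ, (Real.cos (2 * Real.pi * x * y) + Real.sin (2 * Real.pi * x * y)) * H x

open scoped SchwartzMap FourierTransform

theorem sum_range_eq_sum_zmod {M : Type*} [AddCommMonoid M] (n : ℕ) [NeZero n] (c : ℤ → M) :
    ∑ a ∈ Finset.range n, c a = ∑ z : ZMod n, c z.val := by
  refine Finset.sum_nbij' (fun a => (a : ZMod n)) ZMod.val (by simp)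
    (fun z _ => Finset.mem_range.2 z.val_lt) ?_ (by simp) ?_
  · intro a ha
    exact ZMod.val_cast_of_lt (Finset.mem_range.1 ha)
  · intro a ha
    rw [ZMod.val_cast_of_lt (Finset.mem_range.1 ha)]

theorem Function.Periodic.int_eq_of_intCast_zmod_eq {α : Type*} {n : ℕ} {c : ℤ → α}
    (hc : Function.Periodic c n) {a b : ℤ} (h : (a : ZMod n) = b) : c a = c b := by
  obtain ⟨t, ht⟩ := (ZMod.intCast_eq_intCast_iff_dvd_sub a b n).1 h
  obtain rfl : b = a + t * n := by linarith
  exact (hc.int_mul t a).symm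

theorem sum_range_mul_left_of_isCoprime {M : Type*} [AddCommMonoid M] (n : ℕ) [NeZero n]
    {c : ℤ → M} (hc : Function.Periodic c n) {u : ℤ} (hu : IsCoprime u n) :
    ∑ a ∈ Finset.range n, c (u * a) = ∑ a ∈ Finset.range n, c a := by
  rw [sum_range_eq_sum_zmod n c, sum_range_eq_sum_zmod n (fun a => c (u * a))]
  have hu' : IsUnit (u : ZMod n) := by
    have := hu.map (Int.castRingHom (ZMod n))
    simpa [isCoprime_zero_right] using this
  refine Fintype.sum_equiv hu'.unit.mulLeft _ _ fun z => hc.int_eq_of_intCast_zmod_eq ?_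
  simp

theorem jacobiSym_periodic (n : ℕ) : Function.Periodic (fun a : ℤ => jacobiSym a n) n := fun a =>
  jacobiSym.mod_left' (by simp)

theorem Nat.exists_odd_factorization_of_not_isSquare {n : ℕ} (hn : n ≠ 0) (h : ¬IsSquare n) :
    ∃ p, p.Prime ∧ Odd (n.factorization p) := by
  by_contra! hp
  refine h ?_
  rw [← Nat.prod_factorization_pow_eq_self hn]
  refine Finset.isSquare_prod _ fun p hpn => ?_
  have := hp p (Nat.prime_of_mem_primeFactors hpn)
  exact (Nat.not_odd_iff_even.1 this).isSquare_pow p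

theorem exists_jacobiSym_eq_neg_one {n : ℕ} (hodd : Odd n) (h : ¬IsSquare n) :
    ∃ x : ℤ, jacobiSym x n = -1 := by
  have hn : n ≠ 0 := hodd.pos.ne'
  obtain ⟨p, hp, he⟩ := n.exists_odd_factorization_of_not_isSquare hn h
  have : Fact p.Prime := ⟨hp⟩
  have hp2 : p ≠ 2 := by
    rintro rfl
    have h2 : ¬ 2 ∣ n := hodd.not_two_dvd_nat
    simp [Nat.factorization_eq_zero_of_not_dvd h2] at he
  obtain ⟨r, hr⟩ := FiniteField.exists_nonsquare (F := ZMod p) (by rwa [ZMod.ringChar_zmod_n])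
  have hcop : Nat.Coprime p (ordCompl[p] n) := Nat.coprime_ordCompl hp hn
  obtain ⟨x, hxp, hxm⟩ := Nat.chineseRemainder hcop r.val 1
  refine ⟨x, ?_⟩
  have h1 : jacobiSym x p = -1 := by
    rw [← jacobiSym.legendreSym.to_jacobiSym, legendreSym.eq_neg_one_iff]
    have : ((x : ℤ) : ZMod p) = r := by
      simpa using (ZMod.natCast_eq_natCast_iff _ _ _).2 hxp
    rwa [this]
  have h2 : jacobiSym x (ordCompl[p] n) = 1 := by
    rw [← jacobiSym.one_left (ordCompl[p] n)]
    exact jacobiSym.mod_left' (by exact_mod_cast hxm)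
  rw [← Nat.ordProj_mul_ordCompl_eq_self n p,
    jacobiSym.mul_right' _ (pow_ne_zero _ hp.ne_zero) (Nat.ordCompl_pos p hn).ne',
    jacobiSym.pow_right, h1, h2, he.neg_one_pow, mul_one]

theorem sum_range_jacobiSym_of_not_isSquare {n : ℕ} (hodd : Odd n) (h : ¬IsSquare n) :
    ∑ a ∈ Finset.range n, jacobiSym a n = 0 := by
  have : NeZero n := ⟨hodd.pos.ne'⟩
  obtain ⟨x, hx⟩ := exists_jacobiSym_eq_neg_one hodd h
  have hcop : IsCoprime x n := by
    rw [Int.isCoprime_iff_gcd_eq_one]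
    by_contra hx'
    simp [jacobiSym.eq_zero_iff_not_coprime.2 hx'] at hx
  have := sum_range_mul_left_of_isCoprime n (jacobiSym_periodic n) hcop
  simp only [jacobiSym.mul_left, hx, neg_one_mul, Finset.sum_neg_distrib] at this
  lia

theorem jacobiSym_of_isSquare {n : ℕ} (hn : n ≠ 0) (h : IsSquare n) (a : ℤ) :
    jacobiSym a n = if a.gcd n = 1 then 1 else 0 := by
  obtain ⟨m, rfl⟩ := h
  split_ifs with h
  · have hm : m ≠ 0 := left_ne_zero_of_mul hn
    rw [jacobiSym.mul_right' _ hm hm, ← sq, jacobiSym.sq_one]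
    exact Int.isCoprime_iff_gcd_eq_one.1 (IsCoprime.of_mul_right_left
      (by simpa using Int.isCoprime_iff_gcd_eq_one.2 h))
  · exact jacobiSym.eq_zero_iff.2 ⟨hn, h⟩

theorem sum_range_jacobiSym_of_isSquare {n : ℕ} (hn : n ≠ 0) (h : IsSquare n) :
    ∑ a ∈ Finset.range n, jacobiSym a n = n.totient := by
  simp only [jacobiSym_of_isSquare hn h, Finset.sum_boole, Nat.totient_eq_card_coprime,
    Int.gcd_natCast_natCast, Nat.coprime_iff_gcd_eq_one, Nat.gcd_comm n]

theorem SchwartzMap.summable_intCast (f : 𝓢(ℝ, ℂ)) : Summable fun k : ℤ => f k :=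
  summable_of_isBigO (Real.summable_abs_int_rpow one_lt_two)
    ((f.isBigO_cocompact_rpow (-2)).comp_tendsto Int.tendsto_coe_cofinite)

theorem SchwartzMap.exists_comp_affine {F : Type*} [NormedAddCommGroup F] [NormedSpace ℝ F]
    (f : 𝓢(ℝ, F)) {r : ℝ} (hr : r ≠ 0) (s : ℝ) :
    ∃ g : 𝓢(ℝ, F), ∀ x, g x = f (r * x + s) := by
  refine ⟨compCLMOfAntilipschitz ℝ (g := fun x => r * x + s) (K := ‖r‖₊⁻¹) (by fun_prop)
    (AntilipschitzWith.of_le_mul_dist fun x y => ?_) f, fun x => rfl⟩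
  rw [dist_add_right, dist_eq_norm, dist_eq_norm, ← mul_sub, norm_mul]
  simp [hr]

theorem Function.Periodic.exists_norm_le {n : ℕ} (hn : n ≠ 0) {c : ℤ → ℂ}
    (hc : Function.Periodic c n) : ∃ C, ∀ m, ‖c m‖ ≤ C := by
  have : NeZero n := ⟨hn⟩
  refine ⟨∑ z : ZMod n, ‖c z.val‖, fun m => ?_⟩
  rw [hc.int_eq_of_intCast_zmod_eq (b := ((m : ZMod n).val : ℤ)) (by simp)]
  exact Finset.single_le_sum (f := fun z : ZMod n => ‖c z.val‖) (fun _ _ => norm_nonneg _)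
    (Finset.mem_univ _)

theorem Summable.mul_fourier {u : ℤ → ℂ} (hu : Summable u) (x : UnitAddCircle) :
    Summable fun k => u k * fourier k x := by
  refine Summable.of_norm_bounded hu.norm fun k => ?_
  rw [norm_mul, fourier_apply, Circle.norm_coe, mul_one]

/-- Poisson summation for a Schwartz function twisted by a periodic sequence. -/
theorem SchwartzMap.tsum_periodic_mul (f : 𝓢(ℝ, ℂ)) {n : ℕ} (hn : n ≠ 0) {c : ℤ → ℂ}
    (hc : Function.Periodic c n) (s : ℝ) :
    ∑' m : ℤ, c m * f (m / n + s) =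
      ∑' k : ℤ, (∑ a ∈ Finset.range n, c a * exp (2 * Real.pi * I * a * k / n)) *
        exp (2 * Real.pi * I * k * s) * 𝓕 f k := by
  have : NeZero n := ⟨hn⟩
  have hn' : (n : ℝ) ≠ 0 := Nat.cast_ne_zero.2 hn
  obtain ⟨g, hg⟩ := f.exists_comp_affine (inv_ne_zero hn') s
  obtain ⟨C, hC⟩ := hc.exists_norm_le hn
  have hsum : Summable fun m : ℤ => c m * f (m / n + s) := by
    refine Summable.of_norm_bounded (g.summable_intCast.norm.mul_left C) fun m => ?_
    rw [norm_mul, hg, div_eq_inv_mul]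
    gcongr
    exact hC m
  have hF : Summable fun k : ℤ => 𝓕 f k := (𝓕 f).summable_intCast
  have hFb (a : ℕ) : Summable fun k : ℤ =>
      c a * (𝓕 f k * fourier k ((a / n + s : ℝ) : UnitAddCircle)) := by
    exact (hF.mul_fourier _).mul_left _
  let e : ℤ ≃ Fin n × ℤ := (Int.divModEquiv n).trans (Equiv.prodComm _ _)
  have he (a : Fin n) (j : ℤ) : e.symm (a, j) = j * n + (a : ℕ) := rfl
  have hterm (a : Fin n) (j : ℤ) : c (e.symm (a, j)) * f ((e.symm (a, j) : ℤ) / n + s) =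
      c (a : ℕ) * f ((((a : ℕ) / n + s : ℝ)) + j) := by
    have hj : c (a + j * n) = c (a : ℕ) := hc.int_mul j _
    rw [he, add_comm (j * (n : ℤ)), hj]
    congr 2
    push_cast
    field_simp
    ring
  calc ∑' m : ℤ, c m * f (m / n + s)
      = ∑' p : Fin n × ℤ, c (e.symm p) * f ((e.symm p : ℤ) / n + s) := (e.symm.tsum_eq _).symm
    _ = ∑ a : Fin n, ∑' j : ℤ, c (a : ℕ) * f ((((a : ℕ) / n + s : ℝ)) + j) := by
        have hsum' : Summable fun p : Fin n × ℤ => c (e.symm p) * f ((e.symm p : ℤ) / n + s) :=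
          hsum.comp_injective e.symm.injective
        rw [hsum'.tsum_prod, tsum_fintype]
        simp only [hterm]
    _ = ∑ a ∈ Finset.range n, ∑' k : ℤ,
          c a * (𝓕 f k * fourier k ((a / n + s : ℝ) : UnitAddCircle)) := by
        rw [Finset.sum_range]
        simp only [tsum_mul_left, f.tsum_eq_tsum_fourier]
    _ = _ := by
        rw [← Summable.tsum_finsetSum fun a _ => hFb a]
        refine tsum_congr fun k => ?_
        rw [Finset.sum_mul, Finset.sum_mul]
        refine Finset.sum_congr rfl fun a _ => ?_
        have hexp : fourier k ((a / n + s : ℝ) : UnitAddCircle) =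
            exp (2 * Real.pi * I * a * k / n) * exp (2 * Real.pi * I * k * s) := by
          rw [fourier_coe_apply, ← Complex.exp_add]
          congr 1
          push_cast
          field_simp
        rw [hexp]
        ring

/-- The sum `∑_{a mod n} (a/n) e(ak/n)`. -/
noncomputable def jacobiGaussSum (k : ℤ) (n : ℕ) : ℂ :=
  ∑ a ∈ Finset.range n, (jacobiSym a n : ℂ) * exp (2 * Real.pi * I * a * k / n)

theorem jacobiGaussSum_neg {n : ℕ} (hn : n ≠ 0) (k : ℤ) :
    jacobiGaussSum (-k) n = jacobiSym (-1) n * jacobiGaussSum k n := by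
  have : NeZero n := ⟨hn⟩
  have hper : Function.Periodic
      (fun a : ℤ => (jacobiSym a n : ℂ) * exp (2 * Real.pi * I * a * k / n)) (n : ℤ) := by
    intro a
    have h : 2 * Real.pi * I * ((a + n : ℤ) : ℂ) * k / n =
        2 * Real.pi * I * a * k / n + k * (2 * Real.pi * I) := by
      push_cast
      field_simp
    simp only [h, Complex.exp_add, Complex.exp_int_mul_two_pi_mul_I, mul_one]
    rw [show jacobiSym (a + n) n = jacobiSym a n from jacobiSym_periodic n a]
  have h := sum_range_mul_left_of_isCoprime n hper (u := -1) isCoprime_one_left.neg_left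
  have hsq : (jacobiSym (-1) n : ℂ) * jacobiSym (-1) n = 1 := by
    rw [← Int.cast_mul, ← sq, jacobiSym.sq_one (by simp)]
    simp
  have hneg : jacobiGaussSum k n = jacobiSym (-1) n * jacobiGaussSum (-k) n := by
    simp only [jacobiSym.mul_left (-1)] at h
    rw [jacobiGaussSum, jacobiGaussSum, Finset.mul_sum]
    simp only [Int.cast_natCast] at h
    rw [← h]
    refine Finset.sum_congr rfl fun a _ => ?_
    push_cast
    ring_nf
  rw [hneg, ← mul_assoc, hsq, one_mul]

theorem fourierCheck_div (H : 𝓢(ℝ, ℝ)) {f : 𝓢(ℝ, ℂ)} {r : ℝ} (hr : 0 < r)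
    (hf : ∀ x, f x = H (r * x)) (k : ℝ) :
    (fourierCheck H (k / r) : ℂ) = r * ((1 + I) / 2 * 𝓕 f k + (1 - I) / 2 * 𝓕 f (-k)) := by
  have hint (w : ℝ) : MeasureTheory.Integrable
      fun v : ℝ => Complex.exp (↑(-2 * Real.pi * v * w) * I) • f v := by
    refine f.integrable.norm.mono' (by fun_prop) (.of_forall fun v => ?_)
    rw [norm_smul, Complex.norm_exp_ofReal_mul_I, one_mul]
  have hscale := MeasureTheory.Measure.integral_comp_mul_left (fun x : ℝ =>
    (Real.cos (2 * Real.pi * x * (k / r)) + Real.sin (2 * Real.pi * x * (k / r))) * H x) r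
  rw [abs_of_pos (inv_pos.2 hr), smul_eq_mul, eq_inv_mul_iff_mul_eq₀ hr.ne'] at hscale
  rw [fourierCheck, ← hscale, SchwartzMap.fourier_coe, Real.fourier_real_eq_integral_exp_smul,
    Real.fourier_real_eq_integral_exp_smul, ← MeasureTheory.integral_const_mul ((1 + I) / 2),
    ← MeasureTheory.integral_const_mul ((1 - I) / 2), ← MeasureTheory.integral_add
    ((hint _).const_mul _) ((hint _).const_mul _), Complex.ofReal_mul, ← integral_complex_ofReal]
  congr 2 with v
  have h1 : 2 * Real.pi * (r * v) * (k / r) = 2 * Real.pi * v * k := by field_simp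
  have h2 : (↑(-2 * Real.pi * v * k) : ℂ) * I = ↑(-(2 * Real.pi * v * k)) * I := by
    push_cast; ring
  have h3 : (↑(-2 * Real.pi * v * -k) : ℂ) * I = ↑(2 * Real.pi * v * k) * I := by
    push_cast; ring
  rw [h1, h2, h3, Complex.exp_mul_I, Complex.exp_mul_I, hf, smul_eq_mul, smul_eq_mul]
  generalize 2 * Real.pi * v * k = θ
  push_cast
  rw [Complex.cos_neg, Complex.sin_neg]
  linear_combination (Complex.sin θ * H (r * v)) * Complex.I_sq

theorem tsum_odd_jacobiSym (H : ℝ → ℂ) (hH : ∀ x ≤ 0, H x = 0) {n : ℕ} (hodd : Odd n) :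
    ∑' d : ℕ, (if Odd d then (jacobiSym (8 * d) n : ℂ) * H d else 0) =
      ∑' m : ℤ, (jacobiSym m n : ℂ) * H (2 * m + n) := by
  let F : ℤ → ℂ := fun d => if Odd d then (jacobiSym (8 * d) n : ℂ) * H d else 0
  have hinj : Function.Injective fun m : ℤ => 2 * m + n := fun a b h => by
    simpa using h
  have h1 : ∑' d : ℕ, F d = ∑' d : ℤ, F d := by
    refine Nat.cast_injective.tsum_eq fun d hd => ?_
    by_contra hd'
    have hd0 : d < 0 := by
      by_contra! h
      exact hd' ⟨d.toNat, by simpa using h⟩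
    exact hd (by simp [F, hH d (by exact_mod_cast hd0.le)])
  have h2 : ∑' m : ℤ, F (2 * m + n) = ∑' d : ℤ, F d := by
    refine hinj.tsum_eq fun d hd => ?_
    have hdo : Odd d := by
      by_contra h
      exact hd (by simp [F, h])
    obtain ⟨t, ht⟩ := hdo.sub_odd ((Int.odd_coe_nat n).2 hodd)
    exact ⟨t, by dsimp; linarith⟩
  have h3 (m : ℤ) : F (2 * m + n) = (jacobiSym m n : ℂ) * H (2 * m + n) := by
    have hmodd : Odd (2 * m + (n : ℤ)) := (even_two_mul m).add_odd ((Int.odd_coe_nat n).2 hodd)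
    have hJ : jacobiSym (8 * (2 * m + n)) n = jacobiSym m n := by
      rw [jacobiSym.mod_left' (a₂ := 4 * (4 * m)) (by
        rw [show 8 * (2 * m + (n : ℤ)) = 4 * (4 * m) + n * 8 by ring, Int.add_mul_emod_self_left]),
        jacobiSym.mul_left, jacobiSym.mul_left, jacobiSym.at_four hodd, one_mul, one_mul]
    simp only [F, if_pos hmodd, hJ]
    push_cast
    rfl
  rw [← tsum_congr h3, h2, ← h1]
  simp [F]

theorem gaussG_zero {n : ℕ} (hodd : Odd n) :
    gaussG 0 n = (if IsSquare n then (1 : ℂ) else 0) *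
      (n * ∏ p ∈ n.primeFactors, (1 - 1 / (p : ℂ))) := by
  have hn : n ≠ 0 := hodd.pos.ne'
  have hsum : ∑ a ∈ Finset.range n, (jacobiSym a n : ℂ) *
      exp (2 * Real.pi * I * a * (0 : ℤ) / n) = (∑ a ∈ Finset.range n, jacobiSym a n : ℤ) := by
    simp
  rw [gaussG, hsum]
  split_ifs with h
  · have htot : (n.totient : ℂ) = n * ∏ p ∈ n.primeFactors, (1 - 1 / (p : ℂ)) := by
      have := congrArg (Rat.cast (K := ℂ)) n.totient_eq_mul_prod_factors
      push_cast at this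
      simpa using this
    have hJ : jacobiSym (-1) n = 1 := by simp [jacobiSym_of_isSquare hn h]
    rw [sum_range_jacobiSym_of_isSquare hn h, hJ, ← htot]
    push_cast
    ring
  · rw [sum_range_jacobiSym_of_not_isSquare hodd h]
    simp

/-- Poisson-type summation formula for character sums: for a Schwartz function `H`
supported in `(0, ∞)`, an odd positive integer `n` and `X > 0`,
`∑_{d ≥ 1 odd} (8d/n) H(d/X)` equals the stated main term plus dual sum. -/
theorem poisson_quadratic (H : SchwartzMap ℝ ℝ) (hsupp : ∀ x : ℝ, x ∉ Set.Ioi (0 : ℝ) → H x = 0)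
    (n : ℕ) (hn : 0 < n) (hodd : Odd n) (X : ℝ) (hX : 0 < X) :
    ∑' d : ℕ, (if Odd d then (jacobiSym (8 * d) n : ℂ) * (H (d / X) : ℂ) else 0) =
      (if IsSquare n then (1 : ℂ) else 0) * (X / 2) * (fourierCheck H 0 : ℂ) *
        ∏ p ∈ n.primeFactors, (1 - 1 / (p : ℂ)) +
      (X / 2) * ∑' k : ℤ, (if k ≠ 0 then
        (-1 : ℂ) ^ k * (gaussG k n / n) * (fourierCheck H (X * k / (2 * n)) : ℂ) else 0) := by
  have hn' : (n : ℂ) ≠ 0 := Nat.cast_ne_zero.2 hn.ne'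
  have hXC : (X : ℂ) ≠ 0 := Complex.ofReal_ne_zero.2 hX.ne'
  set r : ℝ := 2 * n / X with hr
  have hr0 : 0 < r := by positivity
  obtain ⟨g, hg⟩ := H.exists_comp_affine hr0.ne' 0
  let f : 𝓢(ℝ, ℂ) := g.postcompCLM Complex.ofRealCLM
  have hf (x : ℝ) : f x = H (r * x) := by simp [f, hg]
  have hF : Summable fun k : ℤ => 𝓕 f k := (𝓕 f).summable_intCast
  set ε : ℂ := (jacobiSym (-1) n : ℂ) with hε
  have hεsq : ε ^ 2 = 1 := by
    rw [hε, ← Int.cast_pow, jacobiSym.sq_one (by simp)]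
    simp
  set α : ℂ := (1 - I) / 2 + ε * (1 + I) / 2 with hα
  have hG (k : ℤ) : gaussG k n = α * jacobiGaussSum k n := rfl
  obtain ⟨C, hC⟩ : ∃ C, ∀ k : ℤ, ‖(-1 : ℂ) ^ k * jacobiGaussSum k n‖ ≤ C := by
    refine ⟨∑ a ∈ Finset.range n, ‖(jacobiSym a n : ℂ)‖, fun k => ?_⟩
    rw [norm_mul, norm_zpow, norm_neg, norm_one, one_zpow, one_mul]
    refine (norm_sum_le _ _).trans_eq (Finset.sum_congr rfl fun a _ => ?_)
    have harg : (2 * Real.pi * I * a * k / n : ℂ) = ((2 * Real.pi * a * k / n : ℝ) : ℂ) * I := by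
      push_cast
      ring
    rw [norm_mul, harg, Complex.norm_exp_ofReal_mul_I, mul_one]
  have hA : Summable fun k : ℤ => (-1 : ℂ) ^ k * jacobiGaussSum k n * 𝓕 f k := by
    refine Summable.of_norm_bounded (hF.norm.mul_left C) fun k => ?_
    rw [norm_mul]
    gcongr
    exact hC k
  set A : ℤ → ℂ := fun k => (-1 : ℂ) ^ k * jacobiGaussSum k n * 𝓕 f k with hAdef
  have hA' : Summable fun k : ℤ => A (-k) := (Equiv.neg ℤ).summable_iff.2 hA
  set B : ℤ → ℂ := fun k =>
    (-1 : ℂ) ^ k * (gaussG k n / n) * (fourierCheck H (X * k / (2 * n)) : ℂ) with hB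
  have hBA (k : ℤ) : B k = 2 / X * (α * ((1 + I) / 2 * A k + (1 - I) / 2 * ε * A (-k))) := by
    have hk : X * k / (2 * n) = k / r := by rw [hr]; field_simp
    have hr' : (r : ℂ) = 2 / X * n := by rw [hr]; push_cast; ring
    have hAneg : ε * A (-k) = (-1) ^ k * jacobiGaussSum k n * 𝓕 f (-(k : ℝ)) := by
      have hpow : (-1 : ℂ) ^ (-k) = (-1) ^ k := by rw [zpow_neg, ← inv_zpow]; norm_num
      simp only [hAdef, hpow, jacobiGaussSum_neg hn.ne', ← hε, Int.cast_neg]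
      linear_combination ((-1) ^ k * jacobiGaussSum k n * 𝓕 f (-(k : ℝ))) * hεsq
    rw [mul_assoc ((1 - I) / 2), hAneg]
    simp only [hB, hAdef, hG, hk, fourierCheck_div H hr0 hf, hr']
    field_simp
  have hBsum : Summable B := by
    rw [show B = _ from funext hBA]
    exact (((hA.mul_left _).add (hA'.mul_left _)).mul_left _).mul_left _
  have hαeq : α * ((1 + I) / 2 + (1 - I) / 2 * ε) = 1 := by
    rw [hα]
    linear_combination ((1 - I ^ 2) / 4) * hεsq + (ε - 1) / 2 * I_sq
  have hBtsum : ∑' k, B k = 2 / X * ∑' k, A k := by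
    have hneg : ∑' k, A (-k) = ∑' k, A k := (Equiv.neg ℤ).tsum_eq A
    rw [tsum_congr hBA, tsum_mul_left, tsum_mul_left,
      (hA.mul_left _).tsum_add (hA'.mul_left _), tsum_mul_left,
      tsum_mul_left, hneg]
    linear_combination (2 / X * ∑' k, A k) * hαeq
  have hLHS : ∑' d : ℕ, (if Odd d then (jacobiSym (8 * d) n : ℂ) * (H (d / X) : ℂ) else 0) =
      ∑' k, A k := by
    rw [tsum_odd_jacobiSym (fun x => (H (x / X) : ℂ)) (fun x hx => ?_) hodd]
    · have hm (m : ℤ) : (H ((2 * m + n) / X) : ℂ) = f (m / n + (1 / 2 : ℝ)) := by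
        rw [hf, hr]
        congr 2
        field_simp
      simp only [hm]
      rw [f.tsum_periodic_mul hn.ne' (c := fun m => (jacobiSym m n : ℂ))
        fun a => congrArg Int.cast (jacobiSym_periodic n a)]
      refine tsum_congr fun k => ?_
      have hk : exp (2 * Real.pi * I * k * (1 / 2 : ℝ)) = (-1 : ℂ) ^ k := by
        rw [← Complex.exp_pi_mul_I, ← Complex.exp_int_mul]
        congr 1
        push_cast
        ring
      rw [hk, mul_comm _ ((-1 : ℂ) ^ k)]
      simp [hAdef, jacobiGaussSum]
    · simpa using hsupp _ fun h => (not_lt.2 (div_nonpos_of_nonpos_of_nonneg hx hX.le)) h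
  have hB0 : B 0 = (if IsSquare n then (1 : ℂ) else 0) * (fourierCheck H 0 : ℂ) *
      ∏ p ∈ n.primeFactors, (1 - 1 / (p : ℂ)) := by
    simp only [hB, gaussG_zero hodd, zpow_zero, Int.cast_zero, mul_zero, zero_div]
    field_simp
  have hsplit := hBsum.tsum_eq_add_tsum_ite 0
  simp only [ne_eq, ite_not]
  rw [hLHS, show ∑' k, A k = X / 2 * ∑' k, B k by rw [hBtsum]; field_simp, hsplit, hB0]
  ring
end

section
/- Let H : ℝ → ℝ be a Schwartz class function whose support is contained in (0, ∞), and let y be a nonzero real number. Then Ȟ(y) = (1/(2π)) ∫_{−∞}^{∞} H̃(1 − (1/2 + it)) · Γ(1/2 + it) · (cos(π(1/2+it)/2) + sgn(y) · sin(π(1/2+it)/2)) · (2π|y|)^{−(1/2+it)} dt, i.e., Ȟ(y) equals the contour integral (1/(2πi)) ∫_{Re(s)=1/2} H̃(1−s) Γ(s) (cos + sgn(y)·sin)(πs/2) (2π|y|)^{−s} ds. -/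
open Complex

/-- The Mellin transform `H̃(s) = ∫_0^∞ H(x) x^{s-1} dx`. -/
noncomputable def mellinT (H : SchwartzMap ℝ ℝ) (s : ℂ) : ℂ :=
  ∫ x in Set.Ioi (0 : ℝ), (H x : ℂ) * (x : ℂ) ^ (s - 1)

open MeasureTheory Set FourierTransform

theorem integrableOn_rpow_mul_exp_neg {s b : ℝ} (hs : -1 < s) (hb : 0 < b) :
    IntegrableOn (fun x : ℝ => x ^ s * Real.exp (-(b * x))) (Ioi 0) := by
  simpa using integrableOn_rpow_mul_exp_neg_mul_rpow hs one_pos hb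

theorem norm_cpow_mul_cexp_neg (a r : ℂ) {x : ℝ} (hx : 0 < x) :
    ‖(x : ℂ) ^ a * cexp (-(r * x))‖ = x ^ a.re * Real.exp (-(r.re * x)) := by
  rw [norm_mul, norm_cpow_eq_rpow_re_of_pos hx, Complex.norm_exp]
  simp

theorem aestronglyMeasurable_cpow_mul_cexp_neg (a r : ℂ) :
    AEStronglyMeasurable (fun x : ℝ => (x : ℂ) ^ a * cexp (-(r * x)))
      (volume.restrict (Ioi 0)) := by
  refine ContinuousOn.aestronglyMeasurable (fun x hx => ContinuousAt.continuousWithinAt ?_)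
    measurableSet_Ioi
  have : ContinuousAt (fun x : ℝ => (x : ℂ) ^ a) x :=
    continuousAt_ofReal_cpow_const _ _ (Or.inr (ne_of_gt hx))
  fun_prop

theorem integrableOn_cpow_mul_cexp_neg {a r : ℂ} (ha : -1 < a.re) (hr : 0 < r.re) :
    IntegrableOn (fun x : ℝ => (x : ℂ) ^ a * cexp (-(r * x))) (Ioi 0) := by
  refine (integrableOn_rpow_mul_exp_neg ha hr).mono'
    (aestronglyMeasurable_cpow_mul_cexp_neg a r) ?_
  filter_upwards [ae_restrict_mem measurableSet_Ioi] with x hx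
  rw [norm_cpow_mul_cexp_neg a r hx]

theorem differentiableOn_integral_cpow_mul_cexp_neg {a : ℂ} (ha : 0 < a.re) :
    DifferentiableOn ℂ (fun r : ℂ => ∫ x : ℝ in Ioi 0, (x : ℂ) ^ (a - 1) * cexp (-(r * x)))
      {r | 0 < r.re} := by
  intro r (hr : 0 < r.re)
  have hmem : {z : ℂ | r.re / 2 < z.re} ∈ nhds r :=
    (isOpen_lt continuous_const continuous_re).mem_nhds (by simp; linarith)
  refine (hasDerivAt_integral_of_dominated_loc_of_deriv_le
    (F' := fun z x => (x : ℂ) ^ (a - 1) * (cexp (-(z * x)) * -x))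
    (bound := fun x => x ^ a.re * Real.exp (-(r.re / 2 * x))) hmem
    (Filter.Eventually.of_forall fun z => aestronglyMeasurable_cpow_mul_cexp_neg _ z)
    (integrableOn_cpow_mul_cexp_neg (by simpa using ha) hr) ?_ ?_
    (integrableOn_rpow_mul_exp_neg (by linarith) (by linarith))
    ?_).2.differentiableAt.differentiableWithinAt
  · simp_rw [← mul_assoc]
    exact (aestronglyMeasurable_cpow_mul_cexp_neg _ r).mul (by fun_prop)
  · filter_upwards [ae_restrict_mem measurableSet_Ioi] with x hx z (hz : _ < _)
    have hx' : 0 < x := hx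
    rw [← mul_assoc, norm_mul, norm_cpow_mul_cexp_neg _ _ hx, norm_neg, norm_real,
      Real.norm_of_nonneg hx'.le, mul_right_comm, sub_re, one_re, Real.rpow_sub_one hx'.ne',
      div_mul_cancel₀ _ hx'.ne']
    gcongr
  · filter_upwards with x z _
    refine HasDerivAt.const_mul _ (HasDerivAt.cexp ?_)
    simpa using ((hasDerivAt_id z).mul_const (x : ℂ)).fun_neg

/-- The integral of `x ^ (a - 1) * exp (-r x)` over the positive half-line, for complex `r`
in the right half-plane. -/
theorem integral_cpow_mul_cexp_neg {a r : ℂ} (ha : 0 < a.re) (hr : 0 < r.re) :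
    ∫ x : ℝ in Ioi 0, (x : ℂ) ^ (a - 1) * cexp (-(r * x)) = r ^ (-a) * Gamma a := by
  have hopen : IsOpen {z : ℂ | 0 < z.re} := isOpen_lt continuous_const continuous_re
  have hd : DifferentiableOn ℂ (fun z : ℂ => z ^ (-a) * Gamma a) {z | 0 < z.re} := by
    intro z hz
    refine DifferentiableAt.differentiableWithinAt ?_
    exact (differentiableAt_id.cpow_const (Or.inl hz)).mul_const _
  refine ((differentiableOn_integral_cpow_mul_cexp_neg ha).analyticOnNhd
    hopen).eqOn_of_preconnected_of_frequently_eq (hd.analyticOnNhd hopen)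
    (convex_halfSpace_re_gt 0).isPreconnected (z₀ := 1) (by simp) ?_ hr
  have htend : Filter.Tendsto (fun t : ℝ => (t : ℂ)) (nhdsWithin 1 (Ioi 1)) (nhdsWithin 1 {1}ᶜ) := by
    refine tendsto_nhdsWithin_iff.2 ⟨?_, ?_⟩
    · exact (continuous_ofReal.tendsto' 1 1 (by simp)).mono_left nhdsWithin_le_nhds
    · filter_upwards [self_mem_nhdsWithin] with t ht
      simpa using ne_of_gt ht
  refine htend.frequently (Filter.Eventually.frequently ?_)
  filter_upwards [self_mem_nhdsWithin] with t (ht : 1 < t)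
  have ht0 : 0 < t := by linarith
  rw [integral_cpow_mul_exp_neg_mul_Ioi ha ht0, one_div, cpow_neg, inv_cpow]
  rw [arg_ofReal_of_nonneg ht0.le]
  exact Real.pi_pos.ne

theorem norm_Gamma_one_half_add_mul_I_sq (t : ℝ) :
    ‖Gamma (1 / 2 + t * I)‖ ^ 2 = Real.pi / Real.cosh (Real.pi * t) := by
  have h := Complex.Gamma_mul_Gamma_one_sub (1 / 2 + t * I)
  have hconj : 1 - (1 / 2 + t * I) = (starRingEnd ℂ) (1 / 2 + t * I) := by
    have h2 : (starRingEnd ℂ) 2 = 2 := Complex.conj_ofNat 2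
    simp only [map_add, map_mul, map_div₀, map_one, h2, conj_ofReal, conj_I]
    ring
  rw [hconj, Gamma_conj, mul_conj, normSq_eq_norm_sq,
    show (Real.pi : ℂ) * (1 / 2 + t * I) = (Real.pi * t : ℝ) * I + Real.pi / 2 by push_cast; ring,
    Complex.sin_add_pi_div_two, Complex.cos_mul_I] at h
  exact_mod_cast h

theorem norm_Gamma_one_half_mul_exp_le {t θ : ℝ} (hθ : |θ| ≤ Real.pi / 2) :
    ‖Gamma (1 / 2 + t * I)‖ * Real.exp (θ * t) ≤ √(2 * Real.pi) := by
  refine Real.le_sqrt_of_sq_le ?_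
  rw [mul_pow, norm_Gamma_one_half_add_mul_I_sq, ← Real.exp_nat_mul, div_mul_eq_mul_div,
    div_le_iff₀ (Real.cosh_pos _), mul_right_comm, mul_comm]
  have h : Real.exp ((2 : ℕ) * (θ * t)) ≤ 2 * Real.cosh (Real.pi * t) := by
    have h1 : ((2 : ℕ) : ℝ) * (θ * t) ≤ |Real.pi * t| := by
      rw [abs_mul, abs_of_pos Real.pi_pos]
      have := le_abs_self (θ * t)
      rw [abs_mul] at this
      push_cast
      nlinarith [abs_nonneg t]
    refine (Real.exp_le_exp.2 h1).trans ?_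
    rw [← Real.cosh_abs, Real.cosh_eq]
    linarith [Real.exp_pos (-|Real.pi * t|)]
  nlinarith [Real.pi_pos]

theorem SchwartzMap.mellinConvergent (F : SchwartzMap ℝ ℂ) {s : ℂ} (hs : 0 < s.re) :
    MellinConvergent F s := by
  refine mellinConvergent_of_isBigO_rpow (a := s.re + 1) (b := 0)
    (F.continuous.locallyIntegrable.locallyIntegrableOn _) ?_ (by linarith) ?_ hs
  · refine ((F.isBigO_cocompact_rpow (-(s.re + 1))).mono atTop_le_cocompact).congr' .rfl ?_
    filter_upwards [Filter.eventually_ge_atTop 0] with x hx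
    rw [Real.norm_of_nonneg hx]
  · simpa using (F.continuous.tendsto 0).isBigO_one ℝ |>.mono nhdsWithin_le_nhds

/-- The exponential change of variables under which the Mellin transform on the line
`re s = σ` becomes a Fourier transform. -/
noncomputable def expPullback (F : SchwartzMap ℝ ℂ) (σ u : ℝ) : ℂ :=
  Real.exp (-σ * u) • F (Real.exp (-u))

theorem hasDerivAt_exp_neg (u : ℝ) :
    HasDerivAt (fun u : ℝ => Real.exp (-u)) (-Real.exp (-u)) u := by
  simpa using (hasDerivAt_neg u).exp

theorem integrable_expPullback (F : SchwartzMap ℝ ℂ) {σ : ℝ} (hσ : 0 < σ) :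
    Integrable (expPullback F σ) := by
  have h : IntegrableOn (fun x : ℝ => (x : ℂ) ^ ((σ : ℂ) - 1) • F x) (Ioi 0) :=
    F.mellinConvergent (by simpa using hσ)
  have himage : (fun u : ℝ => Real.exp (-u)) '' univ = Ioi 0 := by
    rw [image_univ, ← Real.range_exp]
    exact neg_surjective.range_comp Real.exp
  rw [← himage, integrableOn_image_iff_integrableOn_abs_deriv_smul MeasurableSet.univ
    (f' := fun u => -Real.exp (-u))
    (fun u _ => (hasDerivAt_exp_neg u).hasDerivWithinAt)
    (fun u _ v _ huv => neg_injective (Real.exp_injective huv)), integrableOn_univ] at h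
  refine h.congr (Filter.Eventually.of_forall fun u => ?_)
  have hexp : (Real.exp (-u) : ℂ) ^ ((σ : ℂ) - 1) = (Real.exp (-(σ - 1) * u) : ℝ) := by
    rw [← ofReal_one, ← ofReal_sub, ← ofReal_cpow (Real.exp_pos _).le, ← Real.exp_mul]
    congr 2; ring
  simp only [expPullback, hexp, abs_neg, Real.abs_exp, coe_smul, smul_smul, ← Real.exp_add]
  congr 2; ring

theorem hasDerivAt_expPullback (F : SchwartzMap ℝ ℂ) (σ u : ℝ) :
    HasDerivAt (expPullback F σ)
      (-σ • expPullback F σ u - expPullback (SchwartzMap.derivCLM ℝ ℂ F) (σ + 1) u) u := by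
  have h1 : HasDerivAt (fun u : ℝ => Real.exp (-σ * u)) (Real.exp (-σ * u) * (-σ)) u := by
    simpa using ((hasDerivAt_id u).const_mul (-σ)).exp
  convert! h1.smul ((F.hasDerivAt _).scomp u (hasDerivAt_exp_neg u)) using 1
  simp only [expPullback, SchwartzMap.derivCLM_apply, smul_smul,
    show -(σ + 1) * u = -σ * u + -u by ring, Real.exp_add, mul_neg, neg_mul, neg_smul, smul_neg,
    mul_comm σ, Function.comp_apply]
  abel

theorem deriv_expPullback (F : SchwartzMap ℝ ℂ) (σ : ℝ) :
    deriv (expPullback F σ) =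
      (-σ) • expPullback F σ - expPullback (SchwartzMap.derivCLM ℝ ℂ F) (σ + 1) :=
  funext fun u => (hasDerivAt_expPullback F σ u).deriv

theorem differentiable_expPullback (F : SchwartzMap ℝ ℂ) (σ : ℝ) :
    Differentiable ℝ (expPullback F σ) :=
  fun u => (hasDerivAt_expPullback F σ u).differentiableAt

/-- A function with two integrable derivatives has integrable Fourier transform. -/
theorem integrable_fourier_of_deriv_deriv {g : ℝ → ℂ} (hg : Integrable g)
    (hd : Differentiable ℝ g) (hg' : Integrable (deriv g)) (hd' : Differentiable ℝ (deriv g))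
    (hg'' : Integrable (deriv (deriv g))) : Integrable (𝓕 g) := by
  have hbound (f : ℝ → ℂ) (w : ℝ) : ‖𝓕 f w‖ ≤ ∫ v, ‖f v‖ :=
    VectorFourier.norm_fourierIntegral_le_integral_norm Real.fourierChar volume (innerₗ ℝ) f w
  have hcont : Continuous (𝓕 g) :=
    VectorFourier.fourierIntegral_continuous Real.continuous_fourierChar
      (by fun_prop) hg
  refine (integrable_inv_one_add_sq.const_mul
    ((∫ v, ‖g v‖) + ∫ v, ‖deriv (deriv g) v‖)).mono' hcont.aestronglyMeasurable
    (Filter.Eventually.of_forall fun w => ?_)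
  have h2 := hbound (deriv (deriv g)) w
  rw [Real.fourier_deriv hg' hd' hg'', Real.fourier_deriv hg hd hg'] at h2
  simp only [smul_eq_mul, norm_mul, norm_I, Complex.norm_real, Complex.norm_ofNat,
    Real.norm_of_nonneg Real.pi_pos.le, mul_one] at h2
  have h0 := hbound g w
  rw [← div_eq_mul_inv, le_div_iff₀ (by positivity)]
  have hpi : w ^ 2 ≤ 2 * Real.pi * ‖w‖ * (2 * Real.pi * ‖w‖) := by
    rw [Real.norm_eq_abs, ← sq_abs w, sq]
    have : |w| ≤ 2 * Real.pi * |w| :=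
      le_mul_of_one_le_left (abs_nonneg w) (by linarith [Real.pi_gt_three])
    exact mul_self_le_mul_self (abs_nonneg w) this
  nlinarith [mul_le_mul_of_nonneg_right hpi (norm_nonneg (𝓕 g w))]

theorem SchwartzMap.verticalIntegrable_mellin (F : SchwartzMap ℝ ℂ) {σ : ℝ} (hσ : 0 < σ) :
    VerticalIntegrable (mellin F) σ := by
  set F' := SchwartzMap.derivCLM ℝ ℂ F
  have hint := integrable_expPullback F hσ
  have hint' := integrable_expPullback F' (by linarith : 0 < σ + 1)
  have hderiv : Integrable (deriv (expPullback F σ)) := by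
    rw [deriv_expPullback]
    exact (hint.smul (-σ)).sub hint'
  have hdiff : Differentiable ℝ (deriv (expPullback F σ)) := by
    rw [deriv_expPullback]
    exact ((differentiable_expPullback F σ).const_smul _).sub (differentiable_expPullback F' _)
  have hderiv2 : Integrable (deriv (deriv (expPullback F σ))) := by
    have heq : deriv (deriv (expPullback F σ)) =
        (-σ) • deriv (expPullback F σ) - deriv (expPullback F' (σ + 1)) := by
      funext u
      conv_lhs => rw [deriv_expPullback]
      exact (((differentiable_expPullback F σ u).hasDerivAt.const_smul (-σ)).sub
        (differentiable_expPullback F' (σ + 1) u).hasDerivAt).deriv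
    rw [heq, deriv_expPullback F']
    exact (hderiv.smul (-σ)).sub
      ((hint'.smul (-(σ + 1))).sub (integrable_expPullback _ (by linarith)))
  have h := (integrable_fourier_of_deriv_deriv hint (differentiable_expPullback F σ) hderiv hdiff
    hderiv2).comp_div (by positivity : 2 * Real.pi ≠ 0)
  refine h.congr (Filter.Eventually.of_forall fun t => ?_)
  have hre : ((σ : ℂ) + t * I).re = σ := by simp
  have him : ((σ : ℂ) + t * I).im = t := by simp
  simp only [mellin_eq_fourier, hre, him]
  rfl

theorem SchwartzMap.integrable_mellin_one_half_sub (F : SchwartzMap ℝ ℂ) :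
    Integrable (fun t : ℝ => mellin F (1 / 2 - t * I)) := by
  have h := (F.verticalIntegrable_mellin (by norm_num : (0 : ℝ) < 1 / 2)).comp_neg
  refine h.congr (Filter.Eventually.of_forall fun t => ?_)
  push_cast
  ring_nf

theorem SchwartzMap.eq_integral_mellin (F : SchwartzMap ℝ ℂ) {x : ℝ} (hx : 0 < x) :
    F x = (1 / (2 * Real.pi)) *
      ∫ t : ℝ, (x : ℂ) ^ (-(1 / 2 - t * I)) * mellin F (1 / 2 - t * I) := by
  rw [← mellinInv_mellin_eq (1 / 2) F hx (F.mellinConvergent (by norm_num))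
    (F.verticalIntegrable_mellin (by norm_num)) F.continuous.continuousAt, mellinInv,
    ← integral_neg_eq_self, real_smul]
  push_cast
  simp only [smul_eq_mul, neg_mul, ← sub_eq_add_neg]

/-- Parseval's formula on the line `re s = 1 / 2` for the Laplace transform. -/
theorem SchwartzMap.laplace_eq_integral_mellin (F : SchwartzMap ℝ ℂ) {r : ℂ} (hr : 0 < r.re) :
    ∫ x : ℝ in Ioi 0, cexp (-(r * x)) * F x =
      (1 / (2 * Real.pi)) * ∫ t : ℝ, mellin F (1 / 2 - t * I) *
        (r ^ (-(1 / 2 + t * I)) * Gamma (1 / 2 + t * I)) := by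
  have hM := F.integrable_mellin_one_half_sub
  have hk : IntegrableOn (fun x : ℝ => x ^ (-(1 / 2) : ℝ) * Real.exp (-(r.re * x))) (Ioi 0) :=
    integrableOn_rpow_mul_exp_neg (by norm_num) hr
  have hint : Integrable (Function.uncurry fun (x t : ℝ) =>
      (x : ℂ) ^ (-(1 / 2 - t * I)) * cexp (-(r * x)) * mellin F (1 / 2 - t * I))
      ((volume.restrict (Ioi 0)).prod volume) := by
    refine (hk.mul_prod hM.norm).mono' ?_ ?_
    · refine AEStronglyMeasurable.mul ?_ hM.aestronglyMeasurable.comp_snd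
      exact Measurable.aestronglyMeasurable (by fun_prop)
    · have hpos : ∀ᵐ z : ℝ × ℝ ∂(volume.restrict (Ioi 0)).prod volume, 0 < z.1 :=
        Measure.quasiMeasurePreserving_fst.ae (ae_restrict_mem measurableSet_Ioi)
      filter_upwards [hpos] with z hz
      simp only [Function.uncurry]
      rw [norm_mul, norm_cpow_mul_cexp_neg _ _ hz]
      simp
  calc
    _ = ∫ x : ℝ in Ioi 0, (1 / (2 * Real.pi)) * ∫ t : ℝ,
        (x : ℂ) ^ (-(1 / 2 - t * I)) * cexp (-(r * x)) * mellin F (1 / 2 - t * I) := by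
      refine setIntegral_congr_fun measurableSet_Ioi fun x hx => ?_
      rw [F.eq_integral_mellin hx, mul_left_comm, ← integral_const_mul]
      congr 2
      funext t
      ring
    _ = _ := by
      rw [integral_const_mul, integral_integral_swap hint]
      congr 2
      funext t
      rw [integral_mul_const, mul_comm, mul_comm (r ^ _), mul_comm (Gamma _),
        ← integral_cpow_mul_cexp_neg (by simp) hr]
      congr! 5
      ring

theorem norm_cexp_neg_mul_I_mul (θ t : ℝ) :
    ‖cexp (-(θ * I * (1 / 2 + t * I)))‖ = Real.exp (θ * t) := by
  rw [Complex.norm_exp]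
  congr 1
  simp [Complex.mul_re, Complex.mul_im]

theorem norm_mellinBarnes_kernel_le {c : ℝ} (hc : 0 < c) {θ : ℝ} (hθ : |θ| ≤ Real.pi / 2)
    (t : ℝ) :
    ‖(c : ℂ) ^ (-(1 / 2 + t * I)) * cexp (-(θ * I * (1 / 2 + t * I))) * Gamma (1 / 2 + t * I)‖ ≤
      c ^ (-(1 / 2) : ℝ) * √(2 * Real.pi) := by
  have hre : (-(1 / 2 + t * I)).re = (-(1 / 2) : ℝ) := by simp
  rw [norm_mul, norm_mul, norm_cpow_eq_rpow_re_of_pos hc, hre, norm_cexp_neg_mul_I_mul, mul_assoc,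
    mul_comm (Real.exp _)]
  gcongr
  exact norm_Gamma_one_half_mul_exp_le hθ

theorem continuous_mellinBarnes_kernel {c : ℝ} (hc : 0 < c) (θ : ℝ) :
    Continuous fun t : ℝ => (c : ℂ) ^ (-(1 / 2 + t * I)) * cexp (-(θ * I * (1 / 2 + t * I))) *
      Gamma (1 / 2 + t * I) := by
  have hc' : (c : ℂ) ≠ 0 := ofReal_ne_zero.2 hc.ne'
  have hG : Continuous fun t : ℝ => Gamma (1 / 2 + t * I) := by
    refine continuous_iff_continuousAt.2 fun t => ?_
    refine ContinuousAt.comp (g := Gamma) (differentiableAt_Gamma _ fun m hm => ?_).continuousAt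
      (by fun_prop)
    have := congrArg re hm
    simp at this
    have h0 : (0 : ℝ) ≤ m := m.cast_nonneg
    linarith
  have hpow : Continuous fun t : ℝ => (c : ℂ) ^ (-(1 / 2 + t * I)) :=
    Continuous.const_cpow (by fun_prop) (Or.inl hc')
  fun_prop

theorem SchwartzMap.integrable_mellin_mul_kernel (F : SchwartzMap ℝ ℂ) {c : ℝ} (hc : 0 < c)
    {θ : ℝ} (hθ : |θ| ≤ Real.pi / 2) :
    Integrable fun t : ℝ => mellin F (1 / 2 - t * I) * ((c : ℂ) ^ (-(1 / 2 + t * I)) *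
      cexp (-(θ * I * (1 / 2 + t * I))) * Gamma (1 / 2 + t * I)) :=
  F.integrable_mellin_one_half_sub.mul_bdd
    (continuous_mellinBarnes_kernel hc θ).aestronglyMeasurable
    (Filter.Eventually.of_forall (norm_mellinBarnes_kernel_le hc hθ))

theorem norm_cexp_neg_mul_cexp_le {c x θ : ℝ} (hc : 0 < c) (hx : 0 < x)
    (hθ : |θ| ≤ Real.pi / 2) : ‖cexp (-(c * cexp (θ * I) * x))‖ ≤ 1 := by
  have hcos := Real.cos_nonneg_of_mem_Icc (abs_le.1 hθ)
  have hre : (-(c * cexp (θ * I) * x)).re = -(c * Real.cos θ * x) := by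
    rw [neg_re, re_mul_ofReal, re_ofReal_mul, exp_ofReal_mul_I_re]
  rw [Complex.norm_exp, hre, Real.exp_le_one_iff]
  have : 0 ≤ c * Real.cos θ * x := by positivity
  linarith

theorem SchwartzMap.integrableOn_cexp_mul (F : SchwartzMap ℝ ℂ) {c θ : ℝ} (hc : 0 < c)
    (hθ : |θ| ≤ Real.pi / 2) :
    IntegrableOn (fun x : ℝ => cexp (-(c * cexp (θ * I) * x)) * F x) (Ioi 0) := by
  refine F.integrable.integrableOn.bdd_mul (c := 1)
    (Continuous.aestronglyMeasurable (by fun_prop)) ?_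
  filter_upwards [ae_restrict_mem measurableSet_Ioi] with x hx
  exact norm_cexp_neg_mul_cexp_le hc hx hθ

/-- Parseval's formula for the Laplace transform on a ray in the closed right half-plane. -/
theorem SchwartzMap.laplace_ray_eq_integral_mellin (F : SchwartzMap ℝ ℂ) {c : ℝ} (hc : 0 < c)
    {θ : ℝ} (hθ : |θ| ≤ Real.pi / 2) :
    ∫ x : ℝ in Ioi 0, cexp (-(c * cexp (θ * I) * x)) * F x =
      (1 / (2 * Real.pi)) * ∫ t : ℝ, mellin F (1 / 2 - t * I) * ((c : ℂ) ^ (-(1 / 2 + t * I)) *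
        cexp (-(θ * I * (1 / 2 + t * I))) * Gamma (1 / 2 + t * I)) := by
  have hpi := Real.pi_pos
  have hne : -(Real.pi / 2) ≠ Real.pi / 2 := by linarith
  have hinterior : EqOn
      (fun θ : ℝ => ∫ x : ℝ in Ioi 0, cexp (-(c * cexp (θ * I) * x)) * F x)
      (fun θ : ℝ => (1 / (2 * Real.pi)) * ∫ t : ℝ, mellin F (1 / 2 - t * I) *
        ((c : ℂ) ^ (-(1 / 2 + t * I)) *
          cexp (-(θ * I * (1 / 2 + t * I))) * Gamma (1 / 2 + t * I)))
      (Ioo (-(Real.pi / 2)) (Real.pi / 2)) := by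
    intro θ hθ
    have hr : 0 < (c * cexp (θ * I)).re := by
      rw [re_ofReal_mul, exp_ofReal_mul_I_re]
      exact mul_pos hc (Real.cos_pos_of_mem_Ioo hθ)
    have hpow (s : ℂ) : (c * cexp (θ * I)) ^ (-s) = (c : ℂ) ^ (-s) * cexp (-(θ * I * s)) := by
      rw [cpow_def_of_ne_zero (by simp [hc.ne']), cpow_def_of_ne_zero (by simp [hc.ne']),
        log_ofReal_mul hc (Complex.exp_ne_zero _), log_exp (by simp; linarith [hθ.1])
        (by simp; linarith [hθ.2]), ofReal_log hc.le, ← Complex.exp_add]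
      congr 1
      ring
    simp only [F.laplace_eq_integral_mellin hr, hpow]
  refine hinterior.of_subset_closure (t := Icc (-(Real.pi / 2)) (Real.pi / 2)) ?_ ?_
    Ioo_subset_Icc_self (closure_Ioo hne).ge (abs_le.1 hθ)
  · refine continuousOn_of_dominated (bound := fun x => ‖F x‖)
      (fun θ hθ => (F.integrableOn_cexp_mul hc (abs_le.2 hθ)).aestronglyMeasurable)
      (fun θ hθ => ?_) F.integrable.norm.integrableOn
      (Filter.Eventually.of_forall fun x => by fun_prop)
    filter_upwards [ae_restrict_mem measurableSet_Ioi] with x hx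
    rw [norm_mul]
    exact mul_le_of_le_one_left (norm_nonneg _) (norm_cexp_neg_mul_cexp_le hc hx (abs_le.2 hθ))
  · refine continuousOn_const.mul (continuousOn_of_dominated
      (bound := fun t : ℝ =>
        ‖mellin F (1 / 2 - t * I)‖ * (c ^ (-(1 / 2) : ℝ) * √(2 * Real.pi)))
      (fun θ hθ => (F.integrable_mellin_mul_kernel hc (abs_le.2 hθ)).aestronglyMeasurable)
      (fun θ hθ => Filter.Eventually.of_forall fun t => ?_)
      (F.integrable_mellin_one_half_sub.norm.mul_const _)
      (Filter.Eventually.of_forall fun t => by fun_prop))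
    rw [norm_mul]
    gcongr
    exact norm_mellinBarnes_kernel_le hc (abs_le.2 hθ) t

theorem cos_add_mul_sin_eq (σ z : ℂ) :
    cos z + σ * sin z = (1 + σ * I) / 2 * cexp (-(I * z)) + (1 - σ * I) / 2 * cexp (I * z) := by
  rw [Complex.cos, Complex.sin, mul_comm z I, neg_mul, mul_comm z I]
  ring

/-- For a Schwartz function `H` supported in `(0, ∞)` and a nonzero real `y`,
`Ȟ(y)` is given by the Mellin–Barnes integral on the line `Re(s) = 1/2`. -/
theorem fourierCheck_eq_mellin_integral (H : SchwartzMap ℝ ℝ)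
    (hsupp : ∀ x : ℝ, x ∉ Set.Ioi (0 : ℝ) → H x = 0) (y : ℝ) (hy : y ≠ 0) :
    (fourierCheck H y : ℂ) =
      (1 / (2 * Real.pi)) *
        ∫ t : ℝ,
          mellinT H (1 - (1 / 2 + t * Complex.I)) * Complex.Gamma (1 / 2 + t * Complex.I) *
            (Complex.cos (Real.pi * (1 / 2 + t * Complex.I) / 2) +
              ((y / |y| : ℝ) : ℂ) * Complex.sin (Real.pi * (1 / 2 + t * Complex.I) / 2)) *
            ((2 * Real.pi * |y| : ℝ) : ℂ) ^ (-(1 / 2 + t * Complex.I)) := by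
  set c : ℝ := 2 * Real.pi * |y| with hc_def
  set σ : ℂ := ((y / |y| : ℝ) : ℂ) with hσ_def
  have hc : 0 < c := by positivity
  set F : SchwartzMap ℝ ℂ := SchwartzMap.postcompCLM (𝕜 := ℝ) ofRealCLM H
  have hF (x : ℝ) : F x = H x := rfl
  have hpos : |Real.pi / 2| ≤ Real.pi / 2 := (abs_of_pos Real.pi_div_two_pos).le
  have hneg : |-(Real.pi / 2)| ≤ Real.pi / 2 := by rwa [abs_neg]
  have hmellin (t : ℝ) : mellinT H (1 - (1 / 2 + t * I)) = mellin F (1 / 2 - t * I) := by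
    rw [mellinT, mellin, show (1 : ℂ) - (1 / 2 + t * I) = 1 / 2 - t * I by ring]
    simp only [hF, smul_eq_mul, mul_comm]
  have hexp_pos : cexp ((Real.pi / 2 : ℝ) * I) = I := by
    push_cast
    exact exp_pi_div_two_mul_I
  have hexp_neg : cexp ((-(Real.pi / 2) : ℝ) * I) = -I := by
    rw [ofReal_neg, neg_mul, Complex.exp_neg, hexp_pos, inv_I]
  have htrig (x : ℝ) : ((Real.cos (2 * Real.pi * x * y) + Real.sin (2 * Real.pi * x * y) : ℝ) : ℂ) =
      cos (c * x) + σ * sin (c * x) := by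
    rw [hσ_def]
    norm_cast
    rcases hy.lt_or_gt with h | h
    · rw [hc_def, abs_of_neg h, div_neg, div_self hy, neg_one_mul, ← Real.sin_neg,
        ← Real.cos_neg (2 * Real.pi * -y * x)]
      ring_nf
    · rw [hc_def, abs_of_pos h, div_self hy, one_mul]
      ring_nf
  have hleft : (fourierCheck H y : ℂ) =
      (1 + σ * I) / 2 * (∫ x : ℝ in Ioi 0,
        cexp (-(c * cexp ((Real.pi / 2 : ℝ) * I) * x)) * F x) +
      (1 - σ * I) / 2 * ∫ x : ℝ in Ioi 0,
        cexp (-(c * cexp ((-(Real.pi / 2) : ℝ) * I) * x)) * F x := by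
    rw [← integral_const_mul, ← integral_const_mul,
      ← integral_add ((F.integrableOn_cexp_mul hc hpos).const_mul _)
        ((F.integrableOn_cexp_mul hc hneg).const_mul _), fourierCheck, ← integral_complex_ofReal,
      ← setIntegral_eq_integral_of_forall_compl_eq_zero (s := Ioi 0)
        fun x hx => by simp [hsupp x hx]]
    congr 1
    funext x
    rw [ofReal_mul, htrig, cos_add_mul_sin_eq, hexp_pos, hexp_neg, hF]
    ring_nf
  rw [hleft, F.laplace_ray_eq_integral_mellin hc hpos, F.laplace_ray_eq_integral_mellin hc hneg,
    mul_left_comm, mul_left_comm ((1 - σ * I) / 2), ← mul_add, ← integral_const_mul,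
    ← integral_const_mul, ← integral_add ((F.integrable_mellin_mul_kernel hc hpos).const_mul _)
      ((F.integrable_mellin_mul_kernel hc hneg).const_mul _)]
  congr 2
  funext t
  rw [hmellin, cos_add_mul_sin_eq]
  push_cast
  ring_nf
end

section
/- Let 0 < a ≤ b be real numbers. There exists a constant C > 0 such that for every complex number s with a ≤ Re(s) ≤ b and |Im(s)| ≥ 1, one has |Γ(s) · cos(πs/2)| ≤ C · |s|^{Re(s) − 1/2} and |Γ(s) · sin(πs/2)| ≤ C · |s|^{Re(s) − 1/2}. -/
open Complex

/-- `logNormAdd t x = log |x + t i|`. -/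
noncomputable def logNormAdd (t x : ℝ) : ℝ := Real.log ‖(x + t * I : ℂ)‖

lemma logNormAdd_eq (t x : ℝ) : logNormAdd t x = Real.log (x ^ 2 + t ^ 2) / 2 := by
  rw [logNormAdd, Complex.norm_add_mul_I, Real.log_sqrt (by positivity)]

lemma hasDerivAt_logNormAdd {t : ℝ} (ht : t ≠ 0) (x : ℝ) :
    HasDerivAt (logNormAdd t) (x / (x ^ 2 + t ^ 2)) x := by
  have h : x ^ 2 + t ^ 2 ≠ 0 := by positivity
  have := (((hasDerivAt_pow 2 x).add_const (t ^ 2)).log h).div_const 2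
  rw [show logNormAdd t = fun y ↦ Real.log (y ^ 2 + t ^ 2) / 2 from funext (logNormAdd_eq t)]
  refine this.congr_deriv ?_
  field_simp
  push_cast
  ring

lemma abs_div_sq_add_sq_sub_le {t c x y : ℝ} (ht : 1 ≤ |t|) (hc : 0 ≤ c) (hx : c ≤ x)
    (hy : c ≤ y) :
    |x / (x ^ 2 + t ^ 2) - y / (y ^ 2 + t ^ 2)| ≤ |x - y| / (c ^ 2 + 1) := by
  have ht2 : 1 ≤ t ^ 2 := by rw [← sq_abs]; nlinarith
  have hX : c ^ 2 + 1 ≤ x ^ 2 + t ^ 2 := by nlinarith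
  have hY : c ^ 2 + 1 ≤ y ^ 2 + t ^ 2 := by nlinarith
  have hX0 : 0 < x ^ 2 + t ^ 2 := by nlinarith
  have hY0 : 0 < y ^ 2 + t ^ 2 := by nlinarith
  have key : (c ^ 2 + 1) * |t ^ 2 - x * y| ≤ (x ^ 2 + t ^ 2) * (y ^ 2 + t ^ 2) := by
    have h1 : c ^ 2 + 1 ≤ t ^ 2 + x * y := by nlinarith [mul_le_mul hx hy hc (hc.trans hx)]
    have h2 : |t ^ 2 - x * y| ≤ t ^ 2 + x * y := by
      have : 0 ≤ x * y := mul_nonneg (hc.trans hx) (hc.trans hy)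
      rw [abs_le]; constructor <;> nlinarith
    have h3 : 0 ≤ t ^ 2 + x * y := (abs_nonneg _).trans h2
    calc (c ^ 2 + 1) * |t ^ 2 - x * y| ≤ (t ^ 2 + x * y) * (t ^ 2 + x * y) := by gcongr
      _ ≤ _ := by nlinarith [mul_nonneg (sq_nonneg t) (sq_nonneg (x - y))]
  have e : x / (x ^ 2 + t ^ 2) - y / (y ^ 2 + t ^ 2) =
      (x - y) * ((t ^ 2 - x * y) / ((x ^ 2 + t ^ 2) * (y ^ 2 + t ^ 2))) := by
    field_simp
    ring
  rw [e, abs_mul, div_eq_mul_inv |x - y|, abs_div, abs_of_pos (mul_pos hX0 hY0)]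
  gcongr
  rw [div_le_iff₀ (by positivity), inv_mul_eq_div, le_div_iff₀ (by positivity)]
  linarith

lemma abs_logNormAdd_sub_le {t c M x y : ℝ} (ht : 1 ≤ |t|) (hc : 0 ≤ c) (hM : 1 ≤ M)
    (hx : x ∈ Set.Icc c (c + M)) (hy : y ∈ Set.Icc c (c + M)) :
    |logNormAdd t x - logNormAdd t y - (x - y) * (logNormAdd t (c + 1) - logNormAdd t c)| ≤
      M ^ 2 * (1 / (c ^ 2 + 1)) := by
  have ht0 : t ≠ 0 := by rintro rfl; norm_num at ht
  obtain ⟨η, hη, hη'⟩ := exists_hasDerivAt_eq_slope (logNormAdd t) _ (lt_add_one c)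
    (fun z _ ↦ (hasDerivAt_logNormAdd ht0 z).continuousAt.continuousWithinAt)
    (fun z _ ↦ hasDerivAt_logNormAdd ht0 z)
  rw [add_sub_cancel_left, div_one] at hη'
  rw [← hη']
  set d := η / (η ^ 2 + t ^ 2)
  have hbound : ∀ z ∈ Set.Icc c (c + M), ‖z / (z ^ 2 + t ^ 2) - d‖ ≤ M / (c ^ 2 + 1) := by
    intro z hz
    refine (abs_div_sq_add_sq_sub_le ht hc hz.1 hη.1.le).trans ?_
    gcongr
    rw [abs_le]
    constructor <;> linarith [hz.1, hz.2, hη.1, hη.2]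
  have := (convex_Icc c (c + M)).norm_image_sub_le_of_norm_hasDerivWithin_le
    (f := fun z ↦ logNormAdd t z - z * d)
    (fun z _ ↦ ((hasDerivAt_logNormAdd ht0 z).sub
      ((hasDerivAt_id z).mul_const d |>.congr_deriv (one_mul d))).hasDerivWithinAt) hbound hy hx
  rw [Real.norm_eq_abs, Real.norm_eq_abs] at this
  have hxy : |x - y| ≤ M := by
    rw [abs_le]
    constructor <;> linarith [hx.1, hx.2, hy.1, hy.2]
  calc _ = |logNormAdd t x - x * d - (logNormAdd t y - y * d)| := by congr 1; ring
    _ ≤ _ := this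
    _ ≤ M / (c ^ 2 + 1) * M := by gcongr
    _ = _ := by ring

lemma summable_one_div_nat_sq_add_one : Summable fun j : ℕ ↦ 1 / ((j : ℝ) ^ 2 + 1) := by
  rw [← summable_nat_add_iff 1]
  refine Summable.of_nonneg_of_le (fun _ ↦ by positivity) (fun j ↦ ?_)
    ((summable_nat_add_iff 1).2 (Real.summable_one_div_nat_pow.2 one_lt_two))
  gcongr
  linarith

lemma neg_sum_logNormAdd_sub_le {t M x y : ℝ} (ht : 1 ≤ |t|) (hM : 1 ≤ M)
    (hx : x ∈ Set.Icc 0 M) (hy : y ∈ Set.Icc 0 M) (n : ℕ) :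
    -∑ j ∈ Finset.range n, (logNormAdd t (x + j) - logNormAdd t (y + j)) ≤
      M ^ 2 * (∑' j : ℕ, 1 / ((j : ℝ) ^ 2 + 1)) -
        (x - y) * (logNormAdd t n - logNormAdd t 0) := by
  have htel := Finset.sum_range_sub (fun j : ℕ ↦ logNormAdd t j) n
  have hS := summable_one_div_nat_sq_add_one.sum_le_tsum (Finset.range n)
    (fun _ _ ↦ by positivity)
  rw [Nat.cast_zero] at htel
  rw [← htel]
  refine le_trans ?_ (sub_le_sub_right (mul_le_mul_of_nonneg_left hS (sq_nonneg M)) _)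
  rw [Finset.mul_sum, Finset.mul_sum, ← Finset.sum_neg_distrib, ← Finset.sum_sub_distrib]
  refine Finset.sum_le_sum fun j _ ↦ ?_
  have := abs_logNormAdd_sub_le (c := j) (x := x + j) (y := y + j) ht j.cast_nonneg hM
    ⟨by linarith [hx.1], by linarith [hx.2]⟩ ⟨by linarith [hy.1], by linarith [hy.2]⟩
  rw [add_sub_add_right_eq_sub] at this
  push_cast
  linarith [(abs_le.1 this).1]

lemma norm_GammaSeq {t : ℝ} (ht : t ≠ 0) (x : ℝ) {n : ℕ} (hn : n ≠ 0) :
    ‖GammaSeq (x + t * I) n‖ = Real.exp (x * Real.log n + Real.log n.factorial -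
      ∑ j ∈ Finset.range (n + 1), logNormAdd t (x + j)) := by
  have hn' : (0 : ℝ) < n := by positivity
  have hne (j : ℕ) : ‖(x + t * I + j : ℂ)‖ ≠ 0 := by
    rw [norm_ne_zero_iff]
    intro h
    simpa [ht] using congrArg Complex.im h
  rw [GammaSeq, norm_div, norm_mul, norm_natCast_cpow_of_pos (Nat.pos_of_ne_zero hn),
    Real.exp_sub, Real.exp_add, Real.exp_log (by positivity), Real.exp_sum, norm_prod,
    Real.rpow_def_of_pos hn', Complex.norm_natCast]
  congr 1
  · simp [mul_comm]
  · refine Finset.prod_congr rfl fun j _ ↦ ?_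
    have e : ((x + j : ℝ) + t * I : ℂ) = x + t * I + j := by push_cast; ring
    rw [logNormAdd, e, Real.exp_log ((norm_nonneg _).lt_of_ne' (hne j))]

lemma tendsto_log_sub_logNormAdd (t : ℝ) :
    Filter.Tendsto (fun n : ℕ ↦ Real.log n - logNormAdd t (n + 1 : ℕ)) Filter.atTop (nhds 0) := by
  have h0 : Filter.Tendsto (fun n : ℕ ↦ ((n : ℝ))⁻¹) Filter.atTop (nhds 0) :=
    tendsto_inv_atTop_nhds_zero_nat
  have h1 : Filter.Tendsto
      (fun n : ℕ ↦ -(Real.log ((1 + (n : ℝ)⁻¹) ^ 2 + (t * (n : ℝ)⁻¹) ^ 2) / 2))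
      Filter.atTop (nhds (-(Real.log ((1 + 0) ^ 2 + (t * 0) ^ 2) / 2))) :=
    (((((h0.const_add 1).pow 2).add ((h0.const_mul t).pow 2)).log (by norm_num)).div_const 2).neg
  simp only [mul_zero, add_zero, one_pow, ne_eq, OfNat.ofNat_ne_zero, not_false_eq_true, zero_pow,
    Real.log_one, zero_div, neg_zero] at h1
  refine h1.congr' ?_
  filter_upwards [Filter.eventually_gt_atTop 0] with n hn
  have hn' : (0 : ℝ) < n := by exact_mod_cast hn
  have e : (1 + (n : ℝ)⁻¹) ^ 2 + (t * (n : ℝ)⁻¹) ^ 2 = (((n : ℝ) + 1) ^ 2 + t ^ 2) / n ^ 2 := by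
    field_simp
  rw [logNormAdd_eq, e, Real.log_div (by positivity) (by positivity), Real.log_pow]
  push_cast
  ring

/-- Comparison of the size of `Γ` at two points of the same height. -/
lemma norm_Gamma_le_norm_Gamma_mul {t M x y : ℝ} (ht : 1 ≤ |t|) (hM : 1 ≤ M)
    (hx : x ∈ Set.Icc 0 M) (hy : y ∈ Set.Icc 0 M) :
    ‖Gamma (x + t * I)‖ ≤ ‖Gamma (y + t * I)‖ *
      (Real.exp (M ^ 2 * ∑' j : ℕ, 1 / ((j : ℝ) ^ 2 + 1)) * |t| ^ (x - y)) := by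
  have ht0 : t ≠ 0 := by rintro rfl; norm_num at ht
  set S := M ^ 2 * ∑' j : ℕ, 1 / ((j : ℝ) ^ 2 + 1)
  have hlog0 : logNormAdd t 0 = Real.log |t| := by simp [logNormAdd]
  have hlim : Filter.Tendsto (fun n : ℕ ↦ ‖GammaSeq (y + t * I) n‖ * Real.exp (S +
        (x - y) * ((Real.log n - logNormAdd t (n + 1 : ℕ)) + Real.log |t|))) Filter.atTop
      (nhds (‖Gamma (y + t * I)‖ * Real.exp (S + (x - y) * (0 + Real.log |t|)))) :=
    (GammaSeq_tendsto_Gamma _).norm.mul (Real.continuous_exp.continuousAt.tendsto.comp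
      ((((tendsto_log_sub_logNormAdd t).add_const _).const_mul _).const_add S))
  have hrw : Real.exp (S + (x - y) * (0 + Real.log |t|)) = Real.exp S * |t| ^ (x - y) := by
    rw [Real.exp_add, Real.rpow_def_of_pos (by linarith), zero_add, mul_comm (x - y)]
  rw [← hrw]
  refine le_of_tendsto_of_tendsto (GammaSeq_tendsto_Gamma _).norm hlim ?_
  filter_upwards [Filter.eventually_ne_atTop 0] with n hn
  rw [norm_GammaSeq ht0 x hn, norm_GammaSeq ht0 y hn, ← Real.exp_add, Real.exp_le_exp]
  have := neg_sum_logNormAdd_sub_le ht hM hx hy (n + 1)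
  rw [Finset.sum_sub_distrib, hlog0] at this
  linarith

lemma norm_Gamma_half_add_mul_I_le (t : ℝ) :
    ‖Gamma ((1 / 2 : ℝ) + t * I)‖ ≤ √(2 * Real.pi) * Real.exp (-(Real.pi * |t| / 2)) := by
  have hrefl := congrArg norm (Gamma_mul_Gamma_one_sub ((1 / 2 : ℝ) + t * I))
  have hconj : (1 - ((1 / 2 : ℝ) + t * I) : ℂ) = starRingEnd ℂ ((1 / 2 : ℝ) + t * I) := by
    apply Complex.ext <;> simp
    norm_num
  have hsin : Complex.sin (Real.pi * ((1 / 2 : ℝ) + t * I)) = Real.cosh (Real.pi * t) := by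
    have e : (Real.pi * ((1 / 2 : ℝ) + t * I) : ℂ) = (Real.pi * t : ℝ) * I + Real.pi / 2 := by
      push_cast; ring
    rw [e, Complex.sin_add_pi_div_two, Complex.cos_mul_I, Complex.ofReal_cosh]
  rw [hconj, Gamma_conj, norm_mul, RCLike.norm_conj, hsin, norm_div, Complex.norm_real,
    Complex.norm_real, Real.norm_of_nonneg Real.pi_pos.le,
    Real.norm_of_nonneg (Real.cosh_pos _).le] at hrefl
  refine le_of_sq_le_sq ?_ (by positivity)
  rw [mul_pow, Real.sq_sqrt (by positivity), ← Real.exp_nat_mul, sq, hrefl,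
    div_le_iff₀ (Real.cosh_pos _), ← Real.cosh_abs, abs_mul, abs_of_pos Real.pi_pos, Real.cosh_eq]
  have e1 : ((2 : ℕ) : ℝ) * -(Real.pi * |t| / 2) = -(Real.pi * |t|) := by push_cast; ring
  have h2 : Real.exp (-(Real.pi * |t|)) * Real.exp (Real.pi * |t|) = 1 := by
    rw [← Real.exp_add]; simp
  rw [e1]
  have : 0 ≤ Real.pi * (Real.exp (-(Real.pi * |t|)) * Real.exp (-(Real.pi * |t|))) := by
    positivity
  nlinarith [congrArg (Real.pi * ·) h2]

lemma norm_exp_mul_I_le (z : ℂ) : ‖exp (z * I)‖ ≤ Real.exp |z.im| := by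
  rw [Complex.norm_exp, Real.exp_le_exp]
  simpa using neg_le_abs z.im

lemma norm_exp_neg_mul_I_le (z : ℂ) : ‖exp (-z * I)‖ ≤ Real.exp |z.im| := by
  simpa using norm_exp_mul_I_le (-z)

lemma norm_cos_le_exp_abs_im (z : ℂ) : ‖cos z‖ ≤ Real.exp |z.im| := by
  have := norm_add_le (exp (z * I)) (exp (-z * I))
  rw [Complex.cos, norm_div, Complex.norm_ofNat]
  linarith [norm_exp_mul_I_le z, norm_exp_neg_mul_I_le z]

lemma norm_sin_le_exp_abs_im (z : ℂ) : ‖sin z‖ ≤ Real.exp |z.im| := by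
  have := norm_sub_le (exp (-z * I)) (exp (z * I))
  rw [Complex.sin, norm_div, norm_mul, Complex.norm_I, mul_one, Complex.norm_ofNat]
  linarith [norm_exp_mul_I_le z, norm_exp_neg_mul_I_le z]

lemma abs_im_rpow_le {s : ℂ} {b : ℝ} (h0 : 0 ≤ s.re) (hb : s.re ≤ b) (ht : 1 ≤ |s.im|) :
    |s.im| ^ (s.re - 1 / 2) ≤ (b + 1) * ‖s‖ ^ (s.re - 1 / 2) := by
  have ht0 : 0 < |s.im| := by linarith
  have hs0 : 0 < ‖s‖ := ht0.trans_le (abs_im_le_norm s)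
  have hr : 1 ≤ ‖s‖ / |s.im| := (one_le_div ht0).2 (abs_im_le_norm s)
  have hr' : ‖s‖ / |s.im| ≤ b + 1 := by
    rw [div_le_iff₀ ht0]
    have := norm_le_abs_re_add_abs_im s
    rw [abs_of_nonneg h0] at this
    nlinarith
  have hq : (‖s‖ / |s.im|) ^ (-(s.re - 1 / 2)) ≤ b + 1 :=
    ((Real.rpow_le_rpow_of_exponent_le hr (by linarith)).trans_eq (Real.rpow_one _)).trans hr'
  refine le_trans (le_of_eq ?_) (mul_le_mul_of_nonneg_right hq (Real.rpow_nonneg hs0.le _))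
  rw [Real.rpow_neg (by positivity), Real.div_rpow hs0.le ht0.le]
  have := (Real.rpow_pos_of_pos hs0 (s.re - 1 / 2)).ne'
  field_simp

/-- For `0 < a ≤ b` there is `C > 0` such that `|Γ(s) cos(πs/2)| ≤ C |s|^{Re(s) - 1/2}`
and `|Γ(s) sin(πs/2)| ≤ C |s|^{Re(s) - 1/2}` whenever `a ≤ Re(s) ≤ b` and `|Im(s)| ≥ 1`. -/
theorem gamma_cos_sin_bound (a b : ℝ) (ha : 0 < a) (hab : a ≤ b) :
    ∃ C : ℝ, 0 < C ∧ ∀ s : ℂ, a ≤ s.re → s.re ≤ b → 1 ≤ |s.im| →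
      ‖Complex.Gamma s * Complex.cos (Real.pi * s / 2)‖ ≤ C * ‖s‖ ^ (s.re - 1/2) ∧
      ‖Complex.Gamma s * Complex.sin (Real.pi * s / 2)‖ ≤ C * ‖s‖ ^ (s.re - 1/2) := by
  have hb : 0 < b := ha.trans_le hab
  set E := Real.exp ((b + 1) ^ 2 * ∑' j : ℕ, 1 / ((j : ℝ) ^ 2 + 1))
  have hE : 0 < E := Real.exp_pos _
  refine ⟨√(2 * Real.pi) * E * (b + 1), by positivity, fun s hsa hsb ht ↦ ?_⟩
  have hΓ : ‖Gamma s‖ * Real.exp (Real.pi * |s.im| / 2) ≤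
      √(2 * Real.pi) * E * (b + 1) * ‖s‖ ^ (s.re - 1 / 2) := by
    have h := norm_Gamma_le_norm_Gamma_mul (M := b + 1) (x := s.re) (y := 1 / 2) ht (by linarith)
      ⟨by linarith, by linarith⟩ ⟨by norm_num, by linarith⟩
    rw [re_add_im] at h
    calc ‖Gamma s‖ * Real.exp (Real.pi * |s.im| / 2)
        ≤ √(2 * Real.pi) * Real.exp (-(Real.pi * |s.im| / 2)) *
            (E * ((b + 1) * ‖s‖ ^ (s.re - 1 / 2))) * Real.exp (Real.pi * |s.im| / 2) := by
          gcongr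
          refine h.trans ?_
          gcongr
          · exact norm_Gamma_half_add_mul_I_le s.im
          · exact abs_im_rpow_le (by linarith) hsb ht
      _ = _ := by
          rw [Real.exp_neg]
          field_simp
  have him : |(Real.pi * s / 2 : ℂ).im| = Real.pi * |s.im| / 2 := by
    rw [show (Real.pi * s / 2 : ℂ) = (Real.pi / 2 : ℝ) * s by push_cast; ring, im_ofReal_mul,
      abs_mul, abs_of_pos (by positivity)]
    ring
  rw [norm_mul, norm_mul]
  constructor <;> refine le_trans (mul_le_mul_of_nonneg_left ?_ (norm_nonneg _)) hΓ <;> rw [← him]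
  · exact norm_cos_le_exp_abs_im _
  · exact norm_sin_le_exp_abs_im _
end
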